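/- For every μ ∈ Δ⁺_l, the set Ab_μ of nonempty abelian ideals with rootlet μ is nonempty and contains both a least and a greatest element with respect to inclusion: there exist I(μ)_min, I(μ)_max ∈ Ab_μ such that I(μ)_min ⊆ I ⊆ I(μ)_max for every I ∈ Ab_μ. -/

import Mathlib

open scoped BigOperators

/-- Data of a reduced irreducible crystallographic root system `Δ`, spanning a
`ℚ`-vector space `V` equipped with a Weyl-group-invariant inner product `B`,
together with a chosen system of positive roots `Pos` and the highest root `θ`. -/
structure RootSystemCtx (V : Type*) [AddCommGroup V] [Module ℚ V] where
  /-- the invariant inner product `( , )` -/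
  B : V →ₗ[ℚ] V →ₗ[ℚ] ℚ
  B_symm : ∀ x y : V, B x y = B y x
  B_posdef : ∀ x : V, x ≠ 0 → 0 < B x x
  /-- the set of roots -/
  Δ : Set V
  Δ_finite : Δ.Finite
  Δ_spans : Submodule.span ℚ Δ = ⊤
  zero_notMem_Δ : (0 : V) ∉ Δ
  neg_mem_Δ : ∀ α ∈ Δ, -α ∈ Δ
  reduced : ∀ α ∈ Δ, ∀ c : ℚ, c • α ∈ Δ → c = 1 ∨ c = -1
  crystallographic : ∀ α ∈ Δ, ∀ β ∈ Δ, ∃ n : ℤ, 2 * B α β / B β β = (n : ℚ)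
  reflect_mem : ∀ α ∈ Δ, ∀ β ∈ Δ, β - (2 * B β α / B α α) • α ∈ Δ
  irreducible : ∀ S : Set V, S ⊆ Δ → (∀ α ∈ S, ∀ β ∈ Δ \ S, B α β = 0) → S = ∅ ∨ S = Δ
  /-- the positive roots `Δ⁺` -/
  Pos : Set V
  pos_subset : Pos ⊆ Δ
  mem_pos_or_neg_pos : ∀ α ∈ Δ, α ∈ Pos ∨ -α ∈ Pos
  pos_not_neg : ∀ α ∈ Pos, -α ∉ Pos
  add_pos_mem : ∀ α ∈ Pos, ∀ β ∈ Pos, α + β ∈ Δ → α + β ∈ Pos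
  /-- the highest root `θ` -/
  θ : V
  θ_pos : θ ∈ Pos
  θ_highest : ∀ ν ∈ Δ, θ - ν ∈ AddSubmonoid.closure Pos

namespace RootSystemCtx

variable {V : Type*} [AddCommGroup V] [Module ℚ V] (ctx : RootSystemCtx V)

/-- the simple roots `Π`: indecomposable positive roots -/
def simple : Set V :=
  {α | α ∈ ctx.Pos ∧ ¬∃ β ∈ ctx.Pos, ∃ γ ∈ ctx.Pos, α = β + γ}

/-- `ρ`, the half-sum of all positive roots -/
noncomputable def ρ : V :=
  (1 / 2 : ℚ) • ∑ α ∈ (ctx.Δ_finite.subset ctx.pos_subset).toFinset, α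

/-- the coroot `μ∨ = 2μ/(μ,μ)` -/
noncomputable def coroot (μ : V) : V := (2 / ctx.B μ μ) • μ

/-- `Δ⁺_l`, the long positive roots (roots of the same length as `θ`) -/
def PosLong : Set V := {μ | μ ∈ ctx.Pos ∧ ctx.B μ μ = ctx.B ctx.θ ctx.θ}

/-- `Π_l`, the long simple roots -/
def SimpleLong : Set V := {μ | μ ∈ ctx.simple ∧ ctx.B μ μ = ctx.B ctx.θ ctx.θ}

/-- the dominance order `μ ≼ ν` on the root lattice: `ν - μ` is a nonnegative
integer combination of positive roots -/
def le (μ ν : V) : Prop := ν - μ ∈ AddSubmonoid.closure ctx.Pos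

/-- a (combinatorial) abelian ideal of `Δ⁺` -/
def IsAbelianIdeal (I : Set V) : Prop :=
  I ⊆ ctx.Pos ∧ (∀ μ ∈ I, ∀ ν ∈ I, μ + ν ∉ ctx.Δ) ∧
    ∀ γ ∈ I, ∀ ν ∈ ctx.Pos, γ + ν ∈ ctx.Δ → γ + ν ∈ I

/-- `γ` is a generator of the ideal `I` -/
def IsGenerator (I : Set V) (γ : V) : Prop := γ ∈ I ∧ ∀ α ∈ ctx.Pos, γ - α ∉ I

/-! ### The affine picture: `V̂ = V ⊕ ℚδ ⊕ ℚλ`, modelled as `V × ℚ × ℚ`,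
with `δ = (0,1,0)` and `λ = (0,0,1)`. -/

/-- the embedding of `V` into `V̂` -/
def emb (_ctx : RootSystemCtx V) (v : V) : V × ℚ × ℚ := (v, 0, 0)

/-- the imaginary root `δ` -/
def δhat (_ctx : RootSystemCtx V) : V × ℚ × ℚ := (0, 1, 0)

/-- the affine simple root `α₀ = δ - θ` -/
def alpha0 : V × ℚ × ℚ := (-ctx.θ, 1, 0)

/-- the extension of the inner product to `V̂`, with
`(δ,V)=(λ,V)=(δ,δ)=(λ,λ)=0` and `(δ,λ)=1` -/
noncomputable def Bhat : (V × ℚ × ℚ) →ₗ[ℚ] (V × ℚ × ℚ) →ₗ[ℚ] ℚ :=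
  LinearMap.mk₂ ℚ (fun x y => ctx.B x.1 y.1 + x.2.1 * y.2.2 + x.2.2 * y.2.1)
    (fun x x' y => by
      simp only [Prod.fst_add, Prod.snd_add, map_add, LinearMap.add_apply]; ring)
    (fun c x y => by
      simp only [Prod.smul_fst, Prod.smul_snd, map_smul, LinearMap.smul_apply,
        smul_eq_mul]; ring)
    (fun x y y' => by
      simp only [Prod.fst_add, Prod.snd_add, map_add]; ring)
    (fun c x y => by
      simp only [Prod.smul_fst, Prod.smul_snd, map_smul, smul_eq_mul]; ring)

/-- the set `Δ̂` of affine real roots -/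
def Δhat : Set (V × ℚ × ℚ) := {x | ∃ α ∈ ctx.Δ, ∃ k : ℤ, x = (α, (k : ℚ), 0)}

/-- the set `Δ̂⁺` of positive affine roots -/
def PosHat : Set (V × ℚ × ℚ) :=
  {x | ∃ α ∈ ctx.Pos, x = (α, 0, 0)} ∪
    {x | ∃ α ∈ ctx.Δ, ∃ k : ℤ, 1 ≤ k ∧ x = (α, (k : ℚ), 0)}

/-- the set `Π̂ = Π ∪ {α₀}` of affine simple roots -/
def SimpleHat : Set (V × ℚ × ℚ) :=
  {x | ∃ α ∈ ctx.simple, x = (α, (0 : ℚ), (0 : ℚ))} ∪ {ctx.alpha0}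

/-- the reflection `s_β : x ↦ x − (2(x,β)/(β,β))·β` in `V̂` -/
noncomputable def refl (β : V × ℚ × ℚ) : (V × ℚ × ℚ) ≃ₗ[ℚ] (V × ℚ × ℚ) :=
  if h : ctx.Bhat β β = 0 then LinearEquiv.refl ℚ _
  else
    Module.reflection (x := β) (f := (2 / ctx.Bhat β β) • ctx.Bhat β)
      (by simp only [LinearMap.smul_apply, smul_eq_mul]; field_simp)

/-- the affine Weyl group `Ŵ`, generated by the reflections `s_β`, `β ∈ Δ̂` -/
def What : Subgroup ((V × ℚ × ℚ) ≃ₗ[ℚ] (V × ℚ × ℚ)) :=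
  Subgroup.closure {g | ∃ β ∈ ctx.Δhat, g = ctx.refl β}

/-- the finite Weyl group `W`, generated by the reflections `s_α`, `α ∈ Δ`
(identified with a subgroup of `Ŵ`) -/
def Wfin : Subgroup ((V × ℚ × ℚ) ≃ₗ[ℚ] (V × ℚ × ℚ)) :=
  Subgroup.closure {g | ∃ α ∈ ctx.Δ, g = ctx.refl (α, (0 : ℚ), (0 : ℚ))}

/-- `N̂(w) = {β ∈ Δ̂⁺ : w(β) ∈ −Δ̂⁺}` -/
def Nhat (w : (V × ℚ × ℚ) ≃ₗ[ℚ] (V × ℚ × ℚ)) : Set (V × ℚ × ℚ) :=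
  {β | β ∈ ctx.PosHat ∧ -(w β) ∈ ctx.PosHat}

/-- a minuscule element of `Ŵ`: every element of `N̂(w)` has the form `δ - γ`
with `γ ∈ Δ⁺` -/
def IsMinuscule (w : (V × ℚ × ℚ) ≃ₗ[ℚ] (V × ℚ × ℚ)) : Prop :=
  w ∈ ctx.What ∧ ∀ β ∈ ctx.Nhat w, ∃ γ ∈ ctx.Pos, β = ctx.δhat - ctx.emb γ

/-- the abelian ideal `I_w` corresponding to a minuscule element `w` -/
def idealOf (w : (V × ℚ × ℚ) ≃ₗ[ℚ] (V × ℚ × ℚ)) : Set V :=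
  {γ | γ ∈ ctx.Pos ∧ ctx.δhat - ctx.emb γ ∈ ctx.Nhat w}

/-- the ideal `I` has rootlet `τ(I) = μ`, i.e. `I = I_w` for some minuscule `w`
with `w(α₀) + δ = μ` -/
def HasRootlet (I : Set V) (μ : V) : Prop :=
  ∃ w, ctx.IsMinuscule w ∧ ctx.idealOf w = I ∧ w ctx.alpha0 + ctx.δhat = ctx.emb μ

/-- `Ab_μ`, the set of nonempty abelian ideals with rootlet `μ` -/
def AbFiber (μ : V) : Set (Set V) := {I | I.Nonempty ∧ ctx.HasRootlet I μ}

/-- `N(u) = {γ ∈ Δ⁺ : u(γ) ∈ −Δ⁺}` for `u` in the finite Weyl group -/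
def Nfin (w : (V × ℚ × ℚ) ≃ₗ[ℚ] (V × ℚ × ℚ)) : Set V :=
  {γ | γ ∈ ctx.Pos ∧ -(w (ctx.emb γ)) ∈ ctx.PosHat}

/-- the length `l(u) = #N(u)` of an element of the finite Weyl group -/
noncomputable def lenFin (w : (V × ℚ × ℚ) ≃ₗ[ℚ] (V × ℚ × ℚ)) : ℕ :=
  (ctx.Nfin w).ncard

end RootSystemCtx
namespace RootSystemCtx

variable {V : Type*} [AddCommGroup V] [Module ℚ V] (ctx : RootSystemCtx V)

/-! ### Roots, coroots and pairings -/

lemma ne_zero_of_mem {α : V} (hα : α ∈ ctx.Δ) : α ≠ 0 := fun h => ctx.zero_notMem_Δ (h ▸ hα)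

lemma self_pos {α : V} (hα : α ∈ ctx.Δ) : 0 < ctx.B α α :=
  ctx.B_posdef α (ctx.ne_zero_of_mem hα)

lemma B_coroot (α y : V) : ctx.B (ctx.coroot α) y = 2 / ctx.B α α * ctx.B α y := by
  simp [coroot]

lemma coroot_self {α : V} (hα : α ∈ ctx.Δ) : ctx.B (ctx.coroot α) α = 2 := by
  have := ctx.self_pos hα
  rw [B_coroot]; field_simp

lemma coroot_neg (α : V) : ctx.coroot (-α) = -ctx.coroot α := by simp [coroot]

lemma coroot_pos_iff {α : V} (hα : α ∈ ctx.Δ) (y : V) :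
    0 < ctx.B (ctx.coroot α) y ↔ 0 < ctx.B α y := by
  rw [B_coroot]; exact mul_pos_iff_of_pos_left (div_pos two_pos (ctx.self_pos hα))

lemma coroot_eq_zero_iff {α : V} (hα : α ∈ ctx.Δ) (y : V) :
    ctx.B (ctx.coroot α) y = 0 ↔ ctx.B α y = 0 := by
  have := ctx.self_pos hα
  rw [B_coroot]; simp [this.ne']

lemma coroot_neg_iff {α : V} (hα : α ∈ ctx.Δ) (y : V) :
    ctx.B (ctx.coroot α) y < 0 ↔ ctx.B α y < 0 := by
  have := ctx.coroot_pos_iff hα (-y)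
  simpa using this

lemma exists_int {α β : V} (hα : α ∈ ctx.Δ) (hβ : β ∈ ctx.Δ) :
    ∃ n : ℤ, ctx.B (ctx.coroot α) β = n := by
  obtain ⟨n, hn⟩ := ctx.crystallographic β hβ α hα
  refine ⟨n, ?_⟩
  rw [← hn, B_coroot, ctx.B_symm β α]; ring

open Classical in
/-- The orthogonal reflection of `V` in the vector `α`. -/
noncomputable def sref (α : V) : V ≃ₗ[ℚ] V :=
  if h : α = 0 then LinearEquiv.refl ℚ V
  else Module.reflection (x := α) (f := ctx.B (ctx.coroot α))
    (by have := ctx.B_posdef α h; rw [B_coroot]; field_simp)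

lemma sref_apply (α y : V) : ctx.sref α y = y - ctx.B (ctx.coroot α) y • α := by
  unfold sref
  split_ifs with h
  · simp [h]
  · rfl

lemma sref_mem {α β : V} (hα : α ∈ ctx.Δ) (hβ : β ∈ ctx.Δ) : ctx.sref α β ∈ ctx.Δ := by
  have := ctx.reflect_mem α hα β hβ
  rw [sref_apply, B_coroot, ctx.B_symm α β]
  convert this using 3; ring

lemma sref_mul_self {α : V} (hα : α ∈ ctx.Δ) : ctx.sref α * ctx.sref α = 1 := by
  ext y
  simp only [LinearEquiv.mul_apply, sref_apply, map_sub, map_smul, ctx.coroot_self hα,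
    LinearEquiv.coe_one, id]
  module

lemma sref_sref {α : V} (hα : α ∈ ctx.Δ) (y : V) : ctx.sref α (ctx.sref α y) = y :=
  LinearEquiv.congr_fun (ctx.sref_mul_self hα) y

lemma sref_isometry {α : V} (hα : α ∈ ctx.Δ) (y z : V) :
    ctx.B (ctx.sref α y) (ctx.sref α z) = ctx.B y z := by
  have := ctx.self_pos hα
  simp only [sref_apply, B_coroot, map_sub, map_smul, LinearMap.sub_apply, LinearMap.smul_apply,
    smul_eq_mul, ctx.B_symm y α]
  field_simp
  ring

lemma sref_self {α : V} (hα : α ∈ ctx.Δ) : ctx.sref α α = -α := by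
  rw [sref_apply, ctx.coroot_self hα]; module

lemma coroot_sref {α : V} (hα : α ∈ ctx.Δ) (y : V) :
    ctx.B (ctx.coroot α) (ctx.sref α y) = -ctx.B (ctx.coroot α) y := by
  rw [sref_apply, map_sub, map_smul, ctx.coroot_self hα, smul_eq_mul]; ring

/-- Two non-proportional roots satisfy the strict Cauchy-Schwarz bound on Cartan integers. -/
lemma coroot_mul_lt_four {α β : V} (hα : α ∈ ctx.Δ) (hβ : β ∈ ctx.Δ) (h₁ : β ≠ α)
    (h₂ : β ≠ -α) : ctx.B (ctx.coroot α) β * ctx.B (ctx.coroot β) α < 4 := by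
  have ha := ctx.self_pos hα
  have hb := ctx.self_pos hβ
  have hne : β - (ctx.B α β / ctx.B α α) • α ≠ 0 := by
    intro h
    have h' : (ctx.B α β / ctx.B α α) • α = β := (sub_eq_zero.mp h).symm
    rcases ctx.reduced α hα _ (h'.symm ▸ hβ) with hc | hc
    · rw [hc, one_smul] at h'; exact h₁ h'.symm
    · rw [hc, neg_smul, one_smul] at h'; exact h₂ h'.symm
  have hp := ctx.B_posdef _ hne
  simp only [map_sub, map_smul, LinearMap.sub_apply, LinearMap.smul_apply, smul_eq_mul,
    ctx.B_symm β α] at hp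
  have hp' : ctx.B α β ^ 2 < ctx.B α α * ctx.B β β := by
    field_simp at hp
    nlinarith
  rw [B_coroot, B_coroot, ctx.B_symm β α]
  rw [show 2 / ctx.B α α * ctx.B α β * (2 / ctx.B β β * ctx.B α β)
    = 4 * ctx.B α β ^ 2 / (ctx.B α α * ctx.B β β) by field_simp; ring]
  rw [div_lt_iff₀ (by positivity)]
  linarith

lemma coroot_int_bounds {α β : V} (hα : α ∈ ctx.Δ) (hβ : β ∈ ctx.Δ) (h₁ : β ≠ α)
    (h₂ : β ≠ -α) : ∃ n : ℤ, ctx.B (ctx.coroot α) β = n ∧ -3 ≤ n ∧ n ≤ 3 := by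
  obtain ⟨n, hn⟩ := ctx.exists_int hα hβ
  obtain ⟨m, hm⟩ := ctx.exists_int hβ hα
  have h := ctx.coroot_mul_lt_four hα hβ h₁ h₂
  rw [hn, hm] at h
  have h4 : n * m < 4 := by exact_mod_cast h
  refine ⟨n, hn, ?_⟩
  have p1 := ctx.coroot_pos_iff hα β
  have p2 := ctx.coroot_pos_iff hβ α
  have q1 := ctx.coroot_neg_iff hα β
  have q2 := ctx.coroot_neg_iff hβ α
  rw [ctx.B_symm β α] at p2 q2
  rw [hn] at p1 q1
  rw [hm] at p2 q2
  have e1 : 0 < n ↔ 0 < m := by rw [← @Int.cast_pos ℚ, p1, ← p2, Int.cast_pos]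
  have e2 : n < 0 ↔ m < 0 := by
    rw [← @Int.cast_lt_zero ℚ, q1, ← q2, Int.cast_lt_zero]
  rcases lt_trichotomy n 0 with h0 | h0 | h0
  · have := e2.mp h0
    constructor <;> nlinarith
  · omega
  · have := e1.mp h0
    constructor <;> nlinarith

lemma coroot_eq_neg_one {α β : V} (hα : α ∈ ctx.Δ) (hβ : β ∈ ctx.Δ) (hneg : ctx.B α β < 0)
    (hne : β ≠ -α) : ctx.B (ctx.coroot α) β = -1 ∨ ctx.B (ctx.coroot β) α = -1 := by
  obtain ⟨n, hn⟩ := ctx.exists_int hα hβ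
  obtain ⟨m, hm⟩ := ctx.exists_int hβ hα
  have h₁ : β ≠ α := by
    rintro rfl
    exact absurd (ctx.self_pos hα) hneg.not_gt
  have h := ctx.coroot_mul_lt_four hα hβ h₁ hne
  have q1 := (ctx.coroot_neg_iff hα β).mpr hneg
  have q2 := (ctx.coroot_neg_iff hβ α).mpr (by rwa [ctx.B_symm])
  rw [hn] at q1 h ⊢
  rw [hm] at q2 h ⊢
  have h4 : n * m < 4 := by exact_mod_cast h
  have n0 : n < 0 := by exact_mod_cast q1
  have m0 : m < 0 := by exact_mod_cast q2
  have : n = -1 ∨ m = -1 := by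
    by_contra! hc
    have : n ≤ -2 := by omega
    have : m ≤ -2 := by omega
    nlinarith
  rcases this with rfl | rfl <;> simp

lemma add_mem {α β : V} (hα : α ∈ ctx.Δ) (hβ : β ∈ ctx.Δ) (hneg : ctx.B α β < 0)
    (hne : β ≠ -α) : α + β ∈ ctx.Δ := by
  rcases ctx.coroot_eq_neg_one hα hβ hneg hne with h | h
  · have := ctx.sref_mem hα hβ
    rw [sref_apply, h] at this
    convert this using 1; module
  · have := ctx.sref_mem hβ hα
    rw [sref_apply, h] at this
    convert this using 1; module

lemma sub_mem {α β : V} (hα : α ∈ ctx.Δ) (hβ : β ∈ ctx.Δ) (hpos : 0 < ctx.B α β)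
    (hne : β ≠ α) : α - β ∈ ctx.Δ := by
  rw [sub_eq_add_neg]
  exact ctx.add_mem hα (ctx.neg_mem_Δ β hβ) (by simpa using hpos) (by simpa using hne)

lemma coroot_map {v : V ≃ₗ[ℚ] V} (hv : ∀ y z, ctx.B (v y) (v z) = ctx.B y z) (α : V) :
    ctx.coroot (v α) = v (ctx.coroot α) := by
  simp [coroot, hv]

lemma coroot_add {α β : V} (hα : α ∈ ctx.Δ) (hβ : β ∈ ctx.Δ) (hneg : ctx.B α β < 0)
    (hne : β ≠ -α) : ∃ σ ∈ ctx.Δ, ctx.coroot σ = ctx.coroot α + ctx.coroot β := by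
  have key : ∀ {a b : V}, a ∈ ctx.Δ → b ∈ ctx.Δ → ctx.B (ctx.coroot b) a = -1 →
      ctx.coroot (ctx.sref a b) = ctx.coroot a + ctx.coroot b := by
    intro a b ha hb h
    rw [ctx.coroot_map (ctx.sref_isometry ha), sref_apply, B_coroot, ctx.B_symm a (ctx.coroot b), h]
    simp only [coroot]; module
  rcases ctx.coroot_eq_neg_one hα hβ hneg hne with h | h
  · exact ⟨_, ctx.sref_mem hβ hα, by rw [key hβ hα h, add_comm]⟩
  · exact ⟨_, ctx.sref_mem hα hβ, key hα hβ h⟩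

/-! ### Positive roots and the cone they generate -/

lemma sum_pos_ne_zero (n : ℕ) : ∀ s : Multiset V, s.card = n + 1 → (∀ α ∈ s, α ∈ ctx.Pos) →
    s.sum ≠ 0 := by
  induction n with
  | zero =>
    intro s hs hp h0
    obtain ⟨a, rfl⟩ := Multiset.card_eq_one.mp hs
    exact ctx.ne_zero_of_mem (ctx.pos_subset (hp a (by simp))) (by simpa using h0)
  | succ n ih =>
    intro s hs hp h0
    obtain ⟨a, t, rfl⟩ := Multiset.card_pos_iff_exists_mem.mp (by omega : 0 < s.card) |>.imp
      fun a ha => Multiset.exists_cons_of_mem ha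
    have ha : a ∈ ctx.Pos := hp a (by simp)
    have hsum : ctx.B a a + (t.map (ctx.B a)).sum = 0 := by
      have := congrArg (ctx.B a) h0
      rwa [Multiset.sum_cons, map_add, map_multiset_sum, map_zero] at this
    have hex : ∃ b ∈ t, ctx.B a b < 0 := by
      by_contra! hc
      have : 0 ≤ (t.map (ctx.B a)).sum := Multiset.sum_nonneg (by simpa using hc)
      have := ctx.self_pos (ctx.pos_subset ha)
      linarith
    obtain ⟨b, hb, hab⟩ := hex
    obtain ⟨u, rfl⟩ := Multiset.exists_cons_of_mem hb
    have hbp : b ∈ ctx.Pos := hp b (by simp)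
    have hmem : a + b ∈ ctx.Δ := ctx.add_mem (ctx.pos_subset ha) (ctx.pos_subset hbp) hab
      (fun h => ctx.pos_not_neg a ha (h ▸ hbp))
    refine ih ((a + b) ::ₘ u) (by simpa using hs) ?_ ?_
    · intro c hc
      rcases Multiset.mem_cons.mp hc with rfl | hc
      · exact ctx.add_pos_mem _ ha _ hbp hmem
      · exact hp c (by simp [hc])
    · rw [← h0]; simp [add_assoc]

lemma eq_zero_of_mem_cone {a b : V} (ha : a ∈ AddSubmonoid.closure ctx.Pos)
    (hb : b ∈ AddSubmonoid.closure ctx.Pos) (h : a + b = 0) : a = 0 := by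
  obtain ⟨s, hs, rfl⟩ := AddSubmonoid.exists_multiset_of_mem_closure ha
  obtain ⟨t, ht, rfl⟩ := AddSubmonoid.exists_multiset_of_mem_closure hb
  by_contra hne
  have hcard : s.card ≠ 0 := fun h0 => hne (by simp [Multiset.card_eq_zero.mp h0])
  refine ctx.sum_pos_ne_zero ((s + t).card - 1) (s + t) (by rw [Multiset.card_add]; omega) ?_
    (by simpa using h)
  intro α hα
  rcases Multiset.mem_add.mp hα with h | h
  exacts [hs α h, ht α h]

lemma mem_cone {α : V} (hα : α ∈ ctx.Pos) : α ∈ AddSubmonoid.closure ctx.Pos :=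
  AddSubmonoid.subset_closure hα

lemma pos_finite : ctx.Pos.Finite := ctx.Δ_finite.subset ctx.pos_subset

lemma neg_pos_of_not_pos {α : V} (hα : α ∈ ctx.Δ) (h : α ∉ ctx.Pos) : -α ∈ ctx.Pos :=
  (ctx.mem_pos_or_neg_pos α hα).resolve_left h

lemma add_mem_pos {α β : V} (hα : α ∈ ctx.Pos) (hβ : β ∈ ctx.Pos) (hneg : ctx.B α β < 0) :
    α + β ∈ ctx.Pos :=
  ctx.add_pos_mem _ hα _ hβ <| ctx.add_mem (ctx.pos_subset hα) (ctx.pos_subset hβ) hneg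
    (fun h => ctx.pos_not_neg α hα (h ▸ hβ))

lemma map_nonneg_of_mem_cone {f : V →ₗ[ℚ] ℚ} (hf : ∀ α ∈ ctx.Pos, 0 ≤ f α) {y : V}
    (hy : y ∈ AddSubmonoid.closure ctx.Pos) : 0 ≤ f y := by
  induction hy using AddSubmonoid.closure_induction with
  | mem x hx => exact hf x hx
  | zero => simp
  | add x y _ _ hx hy => rw [map_add]; exact add_nonneg hx hy

lemma θ_mem : ctx.θ ∈ ctx.Δ := ctx.pos_subset ctx.θ_pos

lemma θ_dominant {α : V} (hα : α ∈ ctx.Pos) : 0 ≤ ctx.B ctx.θ α := by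
  by_contra! h
  have h1 := ctx.θ_highest _ (ctx.pos_subset (ctx.add_mem_pos ctx.θ_pos hα h))
  have h2 := ctx.eq_zero_of_mem_cone (ctx.mem_cone hα) h1 (by abel)
  exact ctx.ne_zero_of_mem (ctx.pos_subset hα) h2

/-- A dominant root of maximal length is the highest root. -/
lemma eq_θ_of_dominant {α : V} (hα : α ∈ ctx.Δ) (hl : ctx.B α α = ctx.B ctx.θ ctx.θ)
    (hd : ∀ β ∈ ctx.Pos, 0 ≤ ctx.B α β) : α = ctx.θ := by
  have h1 := ctx.map_nonneg_of_mem_cone hd (ctx.θ_highest α hα)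
  rw [map_sub] at h1
  by_contra hne
  have h2 := ctx.B_posdef (ctx.θ - α) (sub_ne_zero.mpr (Ne.symm hne))
  simp only [map_sub, LinearMap.sub_apply, ctx.B_symm ctx.θ α] at h2
  linarith

lemma coroot_θ_eq_one {α : V} (hα : α ∈ ctx.Pos) (h : 0 < ctx.B ctx.θ α) (hne : α ≠ ctx.θ) :
    ctx.B (ctx.coroot ctx.θ) α = 1 := by
  have hd := ctx.pos_subset hα
  obtain ⟨n, hn⟩ := ctx.exists_int ctx.θ_mem hd
  have hpos := (ctx.coroot_pos_iff ctx.θ_mem α).mpr h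
  rw [hn] at hpos ⊢
  have n0 : 0 < n := by exact_mod_cast hpos
  by_contra hn1
  have n2 : 2 ≤ n := by
    have : n ≠ 1 := fun h => hn1 (by simp [h])
    omega
  have hm : ctx.sref ctx.θ α ∈ ctx.Δ := ctx.sref_mem ctx.θ_mem hd
  have h1 := ctx.θ_highest _ (ctx.neg_mem_Δ _ hm)
  rw [sref_apply, hn] at h1
  have h2 : α - ctx.θ ∈ AddSubmonoid.closure ctx.Pos := by
    have h3 : ((n - 2).toNat) • ctx.θ ∈ AddSubmonoid.closure ctx.Pos :=
      AddSubmonoid.nsmul_mem _ (ctx.mem_cone ctx.θ_pos) _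
    have h4 := AddSubmonoid.add_mem _ h1 h3
    convert h4 using 1
    have : ((n - 2).toNat : ℚ) = n - 2 := by
      have : (((n - 2).toNat : ℤ) : ℚ) = ((n - 2 : ℤ) : ℚ) := by
        rw [Int.toNat_of_nonneg (by omega)]
      push_cast at this; exact this
    rw [← Nat.cast_smul_eq_nsmul ℚ, this]
    module
  have h5 := ctx.eq_zero_of_mem_cone h2 (ctx.θ_highest α hd) (by abel)
  exact hne (sub_eq_zero.mp h5)

/-! ### Simple roots and the height functional -/

lemma simple_pos {α : V} (hα : α ∈ ctx.simple) : α ∈ ctx.Pos := hα.1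

lemma simple_mem {α : V} (hα : α ∈ ctx.simple) : α ∈ ctx.Δ := ctx.pos_subset hα.1

lemma induction_on_simple {p : V → Prop} (hs : ∀ α ∈ ctx.simple, p α)
    (hadd : ∀ β ∈ ctx.Pos, ∀ γ ∈ ctx.Pos, p β → p γ → p (β + γ)) : ∀ α ∈ ctx.Pos, p α := by
  have hlt : ∀ β ∈ ctx.Pos, ∀ γ ∈ ctx.Pos,
      {τ ∈ ctx.Pos | β - τ ∈ AddSubmonoid.closure ctx.Pos}.ncard <
        {τ ∈ ctx.Pos | β + γ - τ ∈ AddSubmonoid.closure ctx.Pos}.ncard ∨ β + γ ∉ ctx.Pos := by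
    intro β hβ γ hγ
    by_cases hmem : β + γ ∈ ctx.Pos
    swap
    · exact Or.inr hmem
    refine Or.inl (Set.ncard_lt_ncard ⟨?_, ?_⟩ (ctx.pos_finite.subset (Set.sep_subset _ _)))
    · rintro τ ⟨hτ, h⟩
      refine ⟨hτ, ?_⟩
      have := AddSubmonoid.add_mem _ h (ctx.mem_cone hγ)
      convert this using 1; abel
    · intro hsub
      have h := (hsub (⟨hmem, by simp⟩ : β + γ ∈ {τ ∈ ctx.Pos |
        β + γ - τ ∈ AddSubmonoid.closure ctx.Pos})).2
      exact ctx.ne_zero_of_mem (ctx.pos_subset hγ)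
        (ctx.eq_zero_of_mem_cone (ctx.mem_cone hγ) h (by abel))
  suffices h : ∀ n : ℕ, ∀ α ∈ ctx.Pos,
      {τ ∈ ctx.Pos | α - τ ∈ AddSubmonoid.closure ctx.Pos}.ncard = n → p α from
    fun α hα => h _ α hα rfl
  intro n
  induction n using Nat.strong_induction_on with
  | _ n ih =>
    intro α hα hn
    by_cases hsimple : α ∈ ctx.simple
    · exact hs α hsimple
    · obtain ⟨β, hβ, γ, hγ, rfl⟩ : ∃ β ∈ ctx.Pos, ∃ γ ∈ ctx.Pos, α = β + γ := by
        by_contra hc; exact hsimple ⟨hα, hc⟩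
      have h1 := (hlt β hβ γ hγ).resolve_right (by simpa using hα)
      have h2 := (hlt γ hγ β hβ).resolve_right (by rw [add_comm]; simpa using hα)
      rw [add_comm γ β] at h2
      exact hadd β hβ γ hγ (ih _ (hn ▸ h1) β hβ rfl) (ih _ (hn ▸ h2) γ hγ rfl)

lemma sref_simple_pos {α β : V} (hα : α ∈ ctx.simple) (hβ : β ∈ ctx.Pos) (hne : β ≠ α) :
    ctx.sref α β ∈ ctx.Pos := by
  have hαΔ := ctx.simple_mem hα
  have hβΔ := ctx.pos_subset hβ
  have hαP := ctx.simple_pos hα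
  by_contra hcon
  have hγ : -ctx.sref α β ∈ ctx.Pos := ctx.neg_pos_of_not_pos (ctx.sref_mem hαΔ hβΔ) hcon
  have hne' : β ≠ -α := fun h => ctx.pos_not_neg α hαP (h ▸ hβ)
  obtain ⟨n, hn, -, hn3⟩ := ctx.coroot_int_bounds hαΔ hβΔ hne hne'
  have hγn : ctx.B (ctx.coroot α) (-ctx.sref α β) = n := by
    rw [map_neg, ctx.coroot_sref hαΔ, hn, neg_neg]
  have hγeq : -ctx.sref α β = (n : ℚ) • α - β := by rw [sref_apply, hn]; module
  rcases le_or_gt n 0 with h0 | h0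
  · obtain ⟨k, rfl⟩ : ∃ k : ℕ, n = -(k : ℤ) := ⟨(-n).toNat, by omega⟩
    have h1 : β + k • α ∈ AddSubmonoid.closure ctx.Pos :=
      AddSubmonoid.add_mem _ (ctx.mem_cone hβ) (AddSubmonoid.nsmul_mem _ (ctx.mem_cone hαP) _)
    have h2 := ctx.eq_zero_of_mem_cone (ctx.mem_cone hγ) h1
      (by rw [hγeq, ← Nat.cast_smul_eq_nsmul ℚ]; push_cast; module)
    exact ctx.ne_zero_of_mem (ctx.pos_subset hγ) h2
  have hγne : -ctx.sref α β ≠ α := by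
    intro h
    apply hne
    have := congrArg (ctx.sref α) h
    rw [map_neg, ctx.sref_sref hαΔ, ctx.sref_self hαΔ] at this
    exact neg_injective this
  -- a positive root pairing positively with the simple root `α` stays positive after `- α`
  have hsub : ∀ τ ∈ ctx.Pos, τ ≠ α → ctx.B (ctx.coroot α) τ = n → τ - α ∈ ctx.Pos := by
    intro τ hτ hτne hτn
    have hp : 0 < ctx.B τ α := by
      rw [ctx.B_symm, ← ctx.coroot_pos_iff hαΔ, hτn]; exact_mod_cast h0
    have hd := ctx.sub_mem (ctx.pos_subset hτ) hαΔ hp (Ne.symm hτne)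
    by_contra hc
    have := ctx.neg_pos_of_not_pos hd hc
    exact hα.2 ⟨τ, hτ, _, this, by abel⟩
  have hA := hsub β hβ hne hn
  have hB := hsub _ hγ hγne hγn
  interval_cases n
  · exact hα.2 ⟨β, hβ, _, hγ, by rw [hγeq]; push_cast; module⟩
  · refine ctx.ne_zero_of_mem (ctx.pos_subset hA)
      (ctx.eq_zero_of_mem_cone (ctx.mem_cone hA) (ctx.mem_cone hB) ?_)
    rw [hγeq]; push_cast; module
  · exact hα.2 ⟨_, hA, _, hB, by rw [hγeq]; push_cast; module⟩

lemma simple_pairing_sum_pos {α : V} (hα : α ∈ ctx.simple) :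
    0 < ctx.B (∑ β ∈ ctx.pos_finite.toFinset, β) α := by
  classical
  have hαΔ := ctx.simple_mem hα
  rw [ctx.B_symm, map_sum, ← Finset.add_sum_erase (a := α) _ _ (by simpa using hα.1)]
  have : ∑ β ∈ ctx.pos_finite.toFinset.erase α, ctx.B α β = 0 := by
    refine Finset.sum_involution (fun β _ => ctx.sref α β) ?_ ?_ ?_ ?_
    · intro β _
      have h := ctx.sref_isometry hαΔ α β
      rw [ctx.sref_self hαΔ, map_neg, LinearMap.neg_apply] at h
      linarith
    · intro β _ hβ h
      rw [sref_apply, sub_eq_self, smul_eq_zero, ctx.coroot_eq_zero_iff hαΔ] at h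
      exact h.elim hβ (ctx.ne_zero_of_mem hαΔ)
    · intro β hβ
      simp only [Finset.mem_erase, Set.Finite.mem_toFinset] at hβ ⊢
      refine ⟨fun h => ?_, ctx.sref_simple_pos hα hβ.2 hβ.1⟩
      have h' := congrArg (ctx.sref α) h
      rw [ctx.sref_sref hαΔ, ctx.sref_self hαΔ] at h'
      exact ctx.pos_not_neg α hα.1 (h' ▸ hβ.2)
    · intro β _
      exact ctx.sref_sref hαΔ β
  rw [this, add_zero]
  exact ctx.self_pos hαΔ

/-- There is a point in the open fundamental alcove. -/
lemma exists_alcove_point : ∃ x : V, (∀ α ∈ ctx.Pos, 0 < ctx.B x α) ∧ ctx.B x ctx.θ < 1 := by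
  set r := ∑ β ∈ ctx.pos_finite.toFinset, β
  have hr : ∀ α ∈ ctx.Pos, 0 < ctx.B r α :=
    ctx.induction_on_simple (fun α hα => ctx.simple_pairing_sum_pos hα)
      (fun β _ γ _ h1 h2 => by rw [map_add]; exact add_pos h1 h2)
  have hθ := hr _ ctx.θ_pos
  refine ⟨(1 / (1 + ctx.B r ctx.θ)) • r, fun α hα => ?_, ?_⟩
  · have := hr α hα
    simp only [map_smul, LinearMap.smul_apply, smul_eq_mul]; positivity
  · simp only [map_smul, LinearMap.smul_apply, smul_eq_mul]
    rw [one_div, inv_mul_eq_div, div_lt_one (by positivity)]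
    linarith

/-- A fixed point of the open fundamental alcove. -/
noncomputable def apt : V := ctx.exists_alcove_point.choose

lemma apt_pos {α : V} (hα : α ∈ ctx.Pos) : 0 < ctx.B ctx.apt α :=
  ctx.exists_alcove_point.choose_spec.1 α hα

lemma apt_lt_one {α : V} (hα : α ∈ ctx.Δ) : ctx.B ctx.apt α < 1 := by
  have h1 := ctx.map_nonneg_of_mem_cone (f := ctx.B ctx.apt) (fun β hβ => (ctx.apt_pos hβ).le)
    (ctx.θ_highest α hα)
  have h2 : ctx.B ctx.apt ctx.θ < 1 := ctx.exists_alcove_point.choose_spec.2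
  rw [map_sub] at h1
  linarith

lemma neg_one_lt_apt {α : V} (hα : α ∈ ctx.Δ) : -1 < ctx.B ctx.apt α := by
  have := ctx.apt_lt_one (ctx.neg_mem_Δ α hα)
  rw [map_neg] at this; linarith

lemma pos_iff {α : V} (hα : α ∈ ctx.Δ) : α ∈ ctx.Pos ↔ 0 < ctx.B ctx.apt α := by
  refine ⟨ctx.apt_pos, fun h => ?_⟩
  by_contra hc
  have := ctx.apt_pos (ctx.neg_pos_of_not_pos hα hc)
  rw [map_neg] at this; linarith

/-- The affine height of a real affine root never vanishes. -/
lemma apt_add_int_ne_zero {α : V} (hα : α ∈ ctx.Δ) (k : ℤ) : ctx.B ctx.apt α + k ≠ 0 := by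
  intro h
  have h1 := ctx.apt_lt_one hα
  have h2 := ctx.neg_one_lt_apt hα
  have h3 : k < 1 := by exact_mod_cast (by linarith : (k : ℚ) < 1)
  have h4 : -1 < k := by exact_mod_cast (by linarith : (-1 : ℚ) < k)
  obtain rfl : k = 0 := by omega
  rw [Int.cast_zero, add_zero] at h
  rcases ctx.mem_pos_or_neg_pos α hα with hp | hp
  · exact (ctx.apt_pos hp).ne' h
  · have := ctx.apt_pos hp
    rw [map_neg, h] at this; simp at this

lemma mem_posHat_iff {α : V} (hα : α ∈ ctx.Δ) (k : ℤ) :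
    ((α, (k : ℚ), 0) : V × ℚ × ℚ) ∈ ctx.PosHat ↔ 0 < ctx.B ctx.apt α + k := by
  have h1 := ctx.apt_lt_one hα
  have h2 := ctx.neg_one_lt_apt hα
  constructor
  · rintro (⟨β, hβ, h⟩ | ⟨β, hβ, m, hm, h⟩)
    · simp only [Prod.mk.injEq, and_true] at h
      rw [h.1, h.2, add_zero]; exact ctx.apt_pos hβ
    · simp only [Prod.mk.injEq, and_true] at h
      have : (1 : ℚ) ≤ m := by exact_mod_cast hm
      rw [h.2]; linarith
  · intro h
    have hk : -1 < k := by exact_mod_cast (by linarith : (-1 : ℚ) < k)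
    rcases (by omega : k = 0 ∨ 1 ≤ k) with rfl | hk
    · exact Or.inl ⟨α, (ctx.pos_iff hα).mpr (by simpa using h), by simp⟩
    · exact Or.inr ⟨α, hα, k, hk, rfl⟩

/-! ### The finite Weyl group acting on `V` -/

/-- The Weyl group, acting on `V` itself. -/
def weyl : Subgroup (V ≃ₗ[ℚ] V) := Subgroup.closure {g | ∃ α ∈ ctx.Δ, g = ctx.sref α}

lemma sref_mem_weyl {α : V} (hα : α ∈ ctx.Δ) : ctx.sref α ∈ ctx.weyl :=
  Subgroup.subset_closure ⟨α, hα, rfl⟩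

lemma weyl_isometry {v : V ≃ₗ[ℚ] V} (hv : v ∈ ctx.weyl) (y z : V) :
    ctx.B (v y) (v z) = ctx.B y z := by
  induction hv using Subgroup.closure_induction generalizing y z with
  | mem v h => obtain ⟨α, hα, rfl⟩ := h; exact ctx.sref_isometry hα y z
  | one => rfl
  | mul a b _ _ ha hb => rw [LinearEquiv.mul_apply, LinearEquiv.mul_apply, ha, hb]
  | inv a _ ha =>
    rw [← ha]
    simp

lemma weyl_mem_iff {v : V ≃ₗ[ℚ] V} (hv : v ∈ ctx.weyl) (y : V) : v y ∈ ctx.Δ ↔ y ∈ ctx.Δ := by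
  induction hv using Subgroup.closure_induction generalizing y with
  | mem v h =>
    obtain ⟨α, hα, rfl⟩ := h
    exact ⟨fun h => ctx.sref_sref hα y ▸ ctx.sref_mem hα h, ctx.sref_mem hα⟩
  | one => rfl
  | mul a b _ _ ha hb => rw [LinearEquiv.mul_apply, ha, hb]
  | inv a _ ha => rw [← ha]; simp

lemma weyl_mem {v : V ≃ₗ[ℚ] V} (hv : v ∈ ctx.weyl) {y : V} (hy : y ∈ ctx.Δ) : v y ∈ ctx.Δ :=
  (ctx.weyl_mem_iff hv y).mpr hy

lemma sref_map {v : V ≃ₗ[ℚ] V} (hv : ∀ y z, ctx.B (v y) (v z) = ctx.B y z) (α : V) :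
    ctx.sref (v α) = v * ctx.sref α * v⁻¹ := by
  ext y
  obtain ⟨z, rfl⟩ := v.surjective y
  have : v⁻¹ (v z) = z := v.symm_apply_apply z
  simp only [LinearEquiv.mul_apply, sref_apply, this, ctx.coroot_map hv, hv, map_sub, map_smul]

lemma sref_neg (α : V) : ctx.sref (-α) = ctx.sref α := by
  ext y; simp [sref_apply, coroot_neg]

/-- Induction on positive roots along a rational-valued function. -/
lemma pos_induction (f : V → ℚ) {p : V → Prop}
    (h : ∀ α ∈ ctx.Pos, (∀ β ∈ ctx.Pos, f β < f α → p β) → p α) : ∀ α ∈ ctx.Pos, p α := by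
  by_contra! hc
  obtain ⟨α, hα, hpα⟩ := hc
  obtain ⟨β, ⟨hβ, hpβ⟩, hmin⟩ := Set.exists_min_image {α ∈ ctx.Pos | ¬p α} f
    (ctx.pos_finite.subset (Set.sep_subset _ _)) ⟨α, hα, hpα⟩
  refine hpβ (h β hβ fun γ hγ hlt => ?_)
  by_contra hpγ
  exact absurd (hmin γ ⟨hγ, hpγ⟩) hlt.not_ge

lemma sref_mem_closure_simple : ∀ α ∈ ctx.Pos,
    ctx.sref α ∈ Subgroup.closure {g | ∃ α ∈ ctx.simple, g = ctx.sref α} := by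
  refine ctx.pos_induction (ctx.B ctx.apt) fun α hα ih => ?_
  by_cases hs : α ∈ ctx.simple
  · exact Subgroup.subset_closure ⟨α, hs, rfl⟩
  obtain ⟨β, hβ, hαβ⟩ : ∃ β ∈ ctx.simple, 0 < ctx.B α β := by
    by_contra! hc
    have := ctx.induction_on_simple (p := fun τ => ctx.B α τ ≤ 0) hc
      (fun β _ γ _ h1 h2 => by rw [map_add]; exact add_nonpos h1 h2) α hα
    exact absurd (ctx.self_pos (ctx.pos_subset hα)) this.not_gt
  have hβΔ := ctx.simple_mem hβ
  have hp := ctx.sref_simple_pos hβ hα (fun h => hs (h ▸ hβ))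
  have hlt : ctx.B ctx.apt (ctx.sref β α) < ctx.B ctx.apt α := by
    rw [sref_apply, map_sub, map_smul, smul_eq_mul]
    have h1 := ctx.apt_pos hβ.1
    have h2 := (ctx.coroot_pos_iff hβΔ α).mpr (by rwa [ctx.B_symm])
    have := mul_pos h2 h1
    linarith
  have hmem := ih _ hp hlt
  have hβm : ctx.sref β ∈ Subgroup.closure {g | ∃ α ∈ ctx.simple, g = ctx.sref α} :=
    Subgroup.subset_closure ⟨β, hβ, rfl⟩
  have := ctx.sref_map (ctx.sref_isometry hβΔ) (ctx.sref β α)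
  rw [ctx.sref_sref hβΔ] at this
  rw [this]
  exact mul_mem (mul_mem hβm hmem) (inv_mem hβm)

lemma weyl_eq_closure_simple :
    ctx.weyl = Subgroup.closure {g | ∃ α ∈ ctx.simple, g = ctx.sref α} := by
  refine le_antisymm ((Subgroup.closure_le _).mpr ?_) (Subgroup.closure_mono ?_)
  · rintro _ ⟨α, hα, rfl⟩
    rcases ctx.mem_pos_or_neg_pos α hα with h | h
    · exact ctx.sref_mem_closure_simple _ h
    · rw [← sref_neg]; exact ctx.sref_mem_closure_simple _ h
  · rintro _ ⟨α, hα, rfl⟩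
    exact ⟨α, ctx.simple_mem hα, rfl⟩

lemma list_prod_mem_weyl {l : List (V ≃ₗ[ℚ] V)}
    (hl : ∀ g ∈ l, ∃ α ∈ ctx.simple, g = ctx.sref α) : l.prod ∈ ctx.weyl :=
  list_prod_mem fun g hg => by
    obtain ⟨α, hα, rfl⟩ := hl g hg
    exact ctx.sref_mem_weyl (ctx.simple_mem hα)

/-- The exchange condition. -/
lemma exchange {α : V} (hα : α ∈ ctx.simple) : ∀ l : List (V ≃ₗ[ℚ] V),
    (∀ g ∈ l, ∃ α ∈ ctx.simple, g = ctx.sref α) → l.prod α ∉ ctx.Pos →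
    ∃ l' : List (V ≃ₗ[ℚ] V), (∀ g ∈ l', ∃ α ∈ ctx.simple, g = ctx.sref α) ∧
      l'.length + 1 = l.length ∧ l.prod * ctx.sref α = l'.prod := by
  intro l
  induction l with
  | nil => intro _ h; exact absurd hα.1 (by simpa using h)
  | cons g m ih =>
    intro hl hneg
    have hm : ∀ g ∈ m, ∃ α ∈ ctx.simple, g = ctx.sref α := fun g hg => hl g (by simp [hg])
    by_cases h : m.prod α ∈ ctx.Pos
    · obtain ⟨β, hβ, rfl⟩ := hl g (by simp)
      have hβΔ := ctx.simple_mem hβ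
      have heq : m.prod α = β := by
        by_contra hne
        exact hneg (by simpa using ctx.sref_simple_pos hβ h hne)
      refine ⟨m, hm, by simp, ?_⟩
      have h1 := ctx.sref_map (ctx.weyl_isometry (ctx.list_prod_mem_weyl hm)) α
      rw [heq] at h1
      rw [List.prod_cons, h1, inv_mul_cancel_right, mul_assoc,
        ctx.sref_mul_self (ctx.simple_mem hα), mul_one]
    · obtain ⟨l', hl', hlen, hprod⟩ := ih hm h
      refine ⟨g :: l', ?_, by simp [hlen], by simp [mul_assoc, hprod]⟩
      intro x hx
      rcases List.mem_cons.mp hx with rfl | hx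
      exacts [hl _ (by simp), hl' x hx]

/-- The Weyl group acts freely on positive systems. -/
lemma weyl_eq_one {v : V ≃ₗ[ℚ] V} (hv : v ∈ ctx.weyl) (hpos : ∀ α ∈ ctx.Pos, v α ∈ ctx.Pos) :
    v = 1 := by
  suffices h : ∀ n : ℕ, ∀ l : List (V ≃ₗ[ℚ] V), l.length = n →
      (∀ g ∈ l, ∃ α ∈ ctx.simple, g = ctx.sref α) → (∀ α ∈ ctx.Pos, l.prod α ∈ ctx.Pos) →
      l.prod = 1 by
    rw [weyl_eq_closure_simple, ← Subgroup.mem_toSubmonoid, Subgroup.closure_toSubmonoid] at hv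
    obtain ⟨l, hl, rfl⟩ := Submonoid.exists_list_of_mem_closure hv
    refine h _ l rfl (fun g hg => ?_) hpos
    rcases hl g hg with h | ⟨α, hα, h⟩
    · exact h
    · refine ⟨α, hα, ?_⟩
      rw [← inv_inv g, h]
      exact inv_eq_of_mul_eq_one_left (ctx.sref_mul_self (ctx.simple_mem hα))
  intro n
  induction n using Nat.strong_induction_on with
  | _ n ih =>
    intro l hlen hl hp
    rcases List.eq_nil_or_concat' l with rfl | ⟨m, g, rfl⟩
    · rfl
    obtain ⟨α, hα, rfl⟩ := hl g (by simp)
    have hprod : (m ++ [ctx.sref α]).prod = m.prod * ctx.sref α := by simp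
    have hm : ∀ g ∈ m, ∃ α ∈ ctx.simple, g = ctx.sref α := fun g hg => hl g (by simp [hg])
    have hneg : m.prod α ∉ ctx.Pos := by
      intro h
      have := hp α hα.1
      rw [hprod, LinearEquiv.mul_apply, ctx.sref_self (ctx.simple_mem hα), map_neg] at this
      exact ctx.pos_not_neg _ h this
    obtain ⟨l', hl', hlen', hprod'⟩ := ctx.exchange hα m hm hneg
    rw [hprod, hprod'] at hp ⊢
    exact ih l'.length (by simp at hlen; omega) l' rfl hl' hp

/-- Every functional is nonnegative on the image of `Pos` under some Weyl group element. -/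
lemma exists_weyl_pos (φ : V →ₗ[ℚ] ℚ) :
    ∃ v ∈ ctx.weyl, ∀ α ∈ ctx.Pos, 0 ≤ φ (v α) := by
  classical
  set r := ∑ β ∈ ctx.pos_finite.toFinset, β with hr
  have hrpos : ∀ α ∈ ctx.Pos, 0 < ctx.B r α :=
    ctx.induction_on_simple (fun α hα => ctx.simple_pairing_sum_pos hα)
      (fun β _ γ _ h1 h2 => by rw [map_add]; exact add_pos h1 h2)
  set S : Set ℚ := (fun v : V ≃ₗ[ℚ] V => φ (v r)) '' (ctx.weyl : Set (V ≃ₗ[ℚ] V))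
  have hfin : S.Finite := by
    refine ((ctx.Δ_finite.toFinset.powerset).image fun T => φ (∑ β ∈ T, β)).finite_toSet.subset ?_
    rintro _ ⟨v, hv, rfl⟩
    simp only [Finset.coe_image, Set.mem_image, Finset.mem_coe, Finset.mem_powerset]
    refine ⟨ctx.pos_finite.toFinset.image v, ?_, ?_⟩
    · intro y hy
      obtain ⟨z, hz, rfl⟩ := Finset.mem_image.mp hy
      simp only [Set.Finite.mem_toFinset] at hz ⊢
      exact ctx.weyl_mem hv (ctx.pos_subset hz)
    · rw [Finset.sum_image (fun a _ b _ h => v.injective h), hr]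
      simp only [map_sum]
  obtain ⟨_, ⟨v, hv, rfl⟩, hmax⟩ := Set.exists_max_image S id hfin ⟨_, 1, one_mem _, rfl⟩
  refine ⟨v, hv, fun α hα => ?_⟩
  have hαΔ := ctx.pos_subset hα
  have h := hmax _ ⟨v * ctx.sref α, mul_mem hv (ctx.sref_mem_weyl hαΔ), rfl⟩
  simp only [id, LinearEquiv.mul_apply, sref_apply, map_sub, map_smul, smul_eq_mul] at h
  have hp := (ctx.coroot_pos_iff hαΔ r).mpr (by rw [ctx.B_symm]; exact hrpos α hα)
  by_contra! hneg
  nlinarith [mul_neg_of_pos_of_neg hp hneg]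

/-! ### The coroot lattice -/

/-- The coroot lattice. -/
def corootLattice : AddSubgroup V := AddSubgroup.closure {y | ∃ α ∈ ctx.Δ, y = ctx.coroot α}

lemma coroot_mem_lattice {α : V} (hα : α ∈ ctx.Δ) : ctx.coroot α ∈ ctx.corootLattice :=
  AddSubgroup.subset_closure ⟨α, hα, rfl⟩

lemma lattice_int {l : V} (hl : l ∈ ctx.corootLattice) {β : V} (hβ : β ∈ ctx.Δ) :
    ∃ n : ℤ, ctx.B l β = n := by
  induction hl using AddSubgroup.closure_induction with
  | mem l h => obtain ⟨α, hα, rfl⟩ := h; exact ctx.exists_int hα hβ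
  | zero => exact ⟨0, by simp⟩
  | add a b _ _ ha hb =>
    obtain ⟨m, hm⟩ := ha
    obtain ⟨n, hn⟩ := hb
    exact ⟨m + n, by simp [hm, hn]⟩
  | neg a _ ha =>
    obtain ⟨m, hm⟩ := ha
    exact ⟨-m, by simp [hm]⟩

lemma weyl_lattice {v : V ≃ₗ[ℚ] V} (hv : v ∈ ctx.weyl) {l : V} (hl : l ∈ ctx.corootLattice) :
    v l ∈ ctx.corootLattice := by
  induction hl using AddSubgroup.closure_induction with
  | mem l h =>
    obtain ⟨α, hα, rfl⟩ := h
    rw [← ctx.coroot_map (ctx.weyl_isometry hv)]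
    exact ctx.coroot_mem_lattice (ctx.weyl_mem hv hα)
  | zero => rw [map_zero]; exact zero_mem _
  | add a b _ _ ha hb => rw [map_add]; exact AddSubgroup.add_mem _ ha hb
  | neg a _ ha => rw [map_neg]; exact neg_mem ha

lemma exists_multiset_of_mem_lattice {l : V} (hl : l ∈ ctx.corootLattice) :
    ∃ s : Multiset V, (∀ α ∈ s, α ∈ ctx.Δ) ∧ (s.map ctx.coroot).sum = l := by
  induction hl using AddSubgroup.closure_induction with
  | mem l h => obtain ⟨α, hα, rfl⟩ := h; exact ⟨{α}, by simpa using hα, by simp⟩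
  | zero => exact ⟨0, by simp, by simp⟩
  | add a b _ _ ha hb =>
    obtain ⟨s, hs, rfl⟩ := ha
    obtain ⟨t, ht, rfl⟩ := hb
    refine ⟨s + t, fun α hα => ?_, by simp⟩
    rcases Multiset.mem_add.mp hα with h | h
    exacts [hs α h, ht α h]
  | neg a _ ha =>
    obtain ⟨s, hs, rfl⟩ := ha
    refine ⟨s.map (- ·), fun α hα => ?_, ?_⟩
    · obtain ⟨β, hβ, rfl⟩ := Multiset.mem_map.mp hα
      exact ctx.neg_mem_Δ β (hs β hβ)
    · simp [coroot_neg]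

/-- A vector of the coroot lattice whose pairings with all roots are at most one vanishes:
the coroot lattice contains no nonzero minuscule coweight. -/
lemma eq_zero_of_mem_lattice {l : V} (hl : l ∈ ctx.corootLattice)
    (hle : ∀ β ∈ ctx.Δ, ctx.B l β ≤ 1) : l = 0 := by
  suffices h : ∀ n : ℕ, ∀ s : Multiset V, s.card = n → (∀ α ∈ s, α ∈ ctx.Δ) →
      (∀ β ∈ ctx.Δ, ctx.B (s.map ctx.coroot).sum β ≤ 1) → (s.map ctx.coroot).sum = 0 by
    obtain ⟨s, hs, rfl⟩ := ctx.exists_multiset_of_mem_lattice hl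
    exact h _ s rfl hs hle
  intro n
  induction n using Nat.strong_induction_on with
  | _ n ih =>
    intro s hn hs hle
    rcases s.empty_or_exists_mem with rfl | ⟨a, ha⟩
    · simp
    obtain ⟨t, rfl⟩ := Multiset.exists_cons_of_mem ha
    have haΔ := hs a (by simp)
    have hex : ∃ b ∈ t, ctx.B a b < 0 := by
      by_contra! hc
      have h1 := hle a haΔ
      rw [Multiset.map_cons, Multiset.sum_cons, map_add, LinearMap.add_apply,
        ctx.coroot_self haΔ, ctx.B_symm, map_multiset_sum, Multiset.map_map] at h1
      have h2 : 0 ≤ (t.map (ctx.B a ∘ ctx.coroot)).sum := by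
        refine Multiset.sum_nonneg fun x hx => ?_
        obtain ⟨b, hb, rfl⟩ := Multiset.mem_map.mp hx
        have hb0 := ctx.self_pos (hs b (by simp [hb]))
        rw [Function.comp, ctx.B_symm, B_coroot, ctx.B_symm b a]
        exact mul_nonneg (by positivity) (hc b hb)
      linarith
    obtain ⟨b, hb, hab⟩ := hex
    obtain ⟨u, rfl⟩ := Multiset.exists_cons_of_mem hb
    have hbΔ := hs b (by simp)
    have hu : ∀ α ∈ u, α ∈ ctx.Δ := fun α hα => hs α (by simp [hα])
    simp only [Multiset.card_cons] at hn
    simp only [Multiset.map_cons, Multiset.sum_cons, ← add_assoc] at hle ⊢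
    by_cases hba : b = -a
    · subst hba
      simp only [coroot_neg, add_neg_cancel, zero_add] at hle ⊢
      exact ih u.card (by omega) u rfl hu hle
    · obtain ⟨σ, hσ, hσe⟩ := ctx.coroot_add haΔ hbΔ hab hba
      rw [← hσe] at hle ⊢
      have := ih (σ ::ₘ u).card (by simp; omega) (σ ::ₘ u) rfl
        (fun α hα => by
          rcases Multiset.mem_cons.mp hα with rfl | h
          exacts [hσ, hu α h])
      simp only [Multiset.map_cons, Multiset.sum_cons] at this
      exact this hle


/-! ### The affine Weyl group at level zero -/

/-- `w` acts on the level-zero part of `V̂` as the linear map `v` followed by a translation. -/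
def ActsAs (w : (V × ℚ × ℚ) ≃ₗ[ℚ] (V × ℚ × ℚ)) (v : V ≃ₗ[ℚ] V) (l : V) : Prop :=
  ∀ (y : V) (k : ℚ), w (y, k, 0) = (v y, k + ctx.B l (v y), 0)

lemma ActsAs.mul {w w' : (V × ℚ × ℚ) ≃ₗ[ℚ] (V × ℚ × ℚ)} {v v' : V ≃ₗ[ℚ] V} {l l' : V}
    (h : ctx.ActsAs w v l) (h' : ctx.ActsAs w' v' l') (hv : v ∈ ctx.weyl) :
    ctx.ActsAs (w * w') (v * v') (l + v l') := by
  intro y k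
  rw [LinearEquiv.mul_apply, h', h, LinearEquiv.mul_apply, map_add, LinearMap.add_apply,
    ctx.weyl_isometry hv]
  ring_nf

lemma ActsAs.inv {w : (V × ℚ × ℚ) ≃ₗ[ℚ] (V × ℚ × ℚ)} {v : V ≃ₗ[ℚ] V} {l : V}
    (h : ctx.ActsAs w v l) (hv : v ∈ ctx.weyl) : ctx.ActsAs w⁻¹ v⁻¹ (-(v⁻¹ l)) := by
  intro y k
  rw [map_neg, LinearMap.neg_apply, ctx.weyl_isometry (inv_mem hv)]
  refine w.injective ?_
  have h1 : w (w⁻¹ (y, k, 0)) = (y, k, 0) := w.apply_symm_apply _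
  have h2 : v (v⁻¹ y) = y := v.apply_symm_apply _
  rw [h1, h, h2]
  ring_nf

lemma actsAs_one : ctx.ActsAs 1 1 0 := fun y k => by simp

lemma actsAs_refl {α : V} (hα : α ∈ ctx.Δ) (k : ℤ) :
    ctx.ActsAs (ctx.refl (α, (k : ℚ), 0)) (ctx.sref α) ((k : ℚ) • ctx.coroot α) := by
  intro y c
  have h0 := ctx.self_pos hα
  have hB : ctx.Bhat (α, (k : ℚ), 0) (α, (k : ℚ), 0) = ctx.B α α := by
    simp [Bhat]
  rw [refl, dif_neg (by rw [hB]; exact h0.ne'), Module.reflection_apply]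
  simp only [map_smul, LinearMap.smul_apply, coroot_sref _ hα, hB]
  simp only [Bhat, LinearMap.mk₂_apply, sref_apply, B_coroot, smul_eq_mul]
  ext
  · simp
  · simp; ring
  · simp

lemma exists_actsAs {w : (V × ℚ × ℚ) ≃ₗ[ℚ] (V × ℚ × ℚ)} (hw : w ∈ ctx.What) :
    ∃ v ∈ ctx.weyl, ∃ l ∈ ctx.corootLattice, ctx.ActsAs w v l := by
  induction hw using Subgroup.closure_induction with
  | mem w h =>
    obtain ⟨_, ⟨α, hα, k, rfl⟩, rfl⟩ := h
    refine ⟨_, ctx.sref_mem_weyl hα, _, ?_, ctx.actsAs_refl hα k⟩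
    rw [Int.cast_smul_eq_zsmul]
    exact zsmul_mem (ctx.coroot_mem_lattice hα) k
  | one => exact ⟨1, one_mem _, 0, zero_mem _, ctx.actsAs_one⟩
  | mul a b _ _ ha hb =>
    obtain ⟨v, hv, l, hl, h⟩ := ha
    obtain ⟨v', hv', l', hl', h'⟩ := hb
    exact ⟨_, mul_mem hv hv', _, AddSubgroup.add_mem _ hl (ctx.weyl_lattice hv hl'),
      h.mul ctx h' hv⟩
  | inv a _ ha =>
    obtain ⟨v, hv, l, hl, h⟩ := ha
    exact ⟨_, inv_mem hv, _, neg_mem (ctx.weyl_lattice (inv_mem hv) hl), h.inv ctx hv⟩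

lemma refl_mem_What {α : V} (hα : α ∈ ctx.Δ) (k : ℤ) : ctx.refl (α, (k : ℚ), 0) ∈ ctx.What :=
  Subgroup.subset_closure ⟨_, ⟨α, hα, k, rfl⟩, rfl⟩

lemma exists_mem_What_actsAs {v : V ≃ₗ[ℚ] V} (hv : v ∈ ctx.weyl) {l : V}
    (hl : l ∈ ctx.corootLattice) : ∃ w ∈ ctx.What, ctx.ActsAs w v l := by
  have h1 : ∃ w ∈ ctx.What, ctx.ActsAs w v 0 := by
    induction hv using Subgroup.closure_induction with
    | mem v h =>
      obtain ⟨α, hα, rfl⟩ := h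
      exact ⟨_, ctx.refl_mem_What hα 0, by simpa using ctx.actsAs_refl hα 0⟩
    | one => exact ⟨1, one_mem _, ctx.actsAs_one⟩
    | mul a b ha _ iha ihb =>
      obtain ⟨w, hw, h⟩ := iha
      obtain ⟨w', hw', h'⟩ := ihb
      exact ⟨_, mul_mem hw hw', by simpa using h.mul ctx h' ha⟩
    | inv a ha iha =>
      obtain ⟨w, hw, h⟩ := iha
      exact ⟨_, inv_mem hw, by simpa using h.inv ctx ha⟩
  have h2 : ∃ w ∈ ctx.What, ctx.ActsAs w 1 l := by
    induction hl using AddSubgroup.closure_induction with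
    | mem l h =>
      obtain ⟨α, hα, rfl⟩ := h
      refine ⟨_, mul_mem (ctx.refl_mem_What hα 1) (ctx.refl_mem_What hα 0), ?_⟩
      have := (ctx.actsAs_refl hα 1).mul ctx (ctx.actsAs_refl hα 0) (ctx.sref_mem_weyl hα)
      rw [ctx.sref_mul_self hα] at this
      simpa using this
    | zero => exact ⟨1, one_mem _, ctx.actsAs_one⟩
    | add a b _ _ iha ihb =>
      obtain ⟨w, hw, h⟩ := iha
      obtain ⟨w', hw', h'⟩ := ihb
      exact ⟨_, mul_mem hw hw', by simpa using h.mul ctx h' (one_mem _)⟩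
    | neg a _ iha =>
      obtain ⟨w, hw, h⟩ := iha
      exact ⟨_, inv_mem hw, by simpa using h.inv ctx (one_mem _)⟩
  obtain ⟨w, hw, h⟩ := h1
  obtain ⟨t, ht, h'⟩ := h2
  exact ⟨t * w, mul_mem ht hw, by simpa using h'.mul ctx h (one_mem _)⟩

/-! ### Abelian ideals with a given rootlet -/

/-- The value at `v y` of the translate of the alcove point `apt` by `l`. -/
noncomputable def height (v : V ≃ₗ[ℚ] V) (l : V) : V →ₗ[ℚ] ℚ :=
  ctx.B (ctx.apt + l) ∘ₗ v.toLinearMap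

lemma height_apply (v : V ≃ₗ[ℚ] V) (l y : V) :
    ctx.height v l y = ctx.B ctx.apt (v y) + ctx.B l (v y) := by simp [height]

/-- Pairs `(v, l)` describing the minuscule elements with rootlet `μ`. -/
structure IsRootletPair (μ : V) (v : V ≃ₗ[ℚ] V) (l : V) : Prop where
  mem_weyl : v ∈ ctx.weyl
  mem_lattice : l ∈ ctx.corootLattice
  pos : ∀ γ ∈ ctx.Pos, 0 < ctx.height v l γ
  map_θ : v ctx.θ = -μ
  pairing : ctx.B l μ = -2

/-- The ideal attached to a pair `(v, l)`. -/
def pairIdeal (v : V ≃ₗ[ℚ] V) (l : V) : Set V := {γ ∈ ctx.Pos | 1 < ctx.height v l γ}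

variable {ctx} {μ : V} {v : V ≃ₗ[ℚ] V} {l : V}

lemma height_add_int_ne_zero (hv : v ∈ ctx.weyl) (hl : l ∈ ctx.corootLattice) {β : V}
    (hβ : β ∈ ctx.Δ) (k : ℤ) : ctx.height v l β + k ≠ 0 := by
  have h := ctx.weyl_mem hv hβ
  obtain ⟨n, hn⟩ := ctx.lattice_int hl h
  rw [height_apply, hn, add_assoc]
  exact_mod_cast ctx.apt_add_int_ne_zero h (n + k)

namespace IsRootletPair

lemma height_θ (hP : ctx.IsRootletPair μ v l) :
    ctx.height v l ctx.θ = 2 - ctx.B ctx.apt μ := by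
  rw [height_apply, hP.map_θ, map_neg, map_neg, hP.pairing]; ring

lemma height_lt_two (hP : ctx.IsRootletPair μ v l) (hμ : μ ∈ ctx.PosLong) {β : V}
    (hβ : β ∈ ctx.Δ) : ctx.height v l β < 2 := by
  have h1 := ctx.map_nonneg_of_mem_cone (f := ctx.height v l) (fun γ hγ => (hP.pos γ hγ).le)
    (ctx.θ_highest β hβ)
  have h2 := ctx.apt_pos hμ.1
  rw [map_sub, hP.height_θ] at h1
  linarith

lemma isAbelianIdeal (hP : ctx.IsRootletPair μ v l) (hμ : μ ∈ ctx.PosLong) :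
    ctx.IsAbelianIdeal (ctx.pairIdeal v l) := by
  refine ⟨Set.sep_subset _ _, fun a ha b hb hab => ?_, fun a ha b hb hab => ?_⟩
  · have := hP.height_lt_two hμ hab
    rw [map_add] at this
    linarith [ha.2, hb.2]
  · refine ⟨ctx.add_pos_mem a ha.1 b hb hab, ?_⟩
    rw [map_add]
    linarith [ha.2, hP.pos b hb]

end IsRootletPair

lemma mem_Nhat_iff {w : (V × ℚ × ℚ) ≃ₗ[ℚ] (V × ℚ × ℚ)} (hw : ctx.ActsAs w v l)
    (hv : v ∈ ctx.weyl) (hl : l ∈ ctx.corootLattice) {α : V} (hα : α ∈ ctx.Δ) (k : ℤ) :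
    ((α, (k : ℚ), 0) : V × ℚ × ℚ) ∈ ctx.Nhat w ↔
      0 < ctx.B ctx.apt α + k ∧ ctx.height v l α + k < 0 := by
  have hvα := ctx.weyl_mem hv (ctx.neg_mem_Δ α hα)
  obtain ⟨n, hn⟩ := ctx.lattice_int hl hvα
  have h : -(w (α, (k : ℚ), 0)) = (v (-α), (((n - k : ℤ)) : ℚ), 0) := by
    rw [hw, Int.cast_sub, ← hn]
    simp [sub_eq_add_neg]
  rw [Nhat, Set.mem_ofPred_eq, ctx.mem_posHat_iff hα, h, ctx.mem_posHat_iff hvα]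
  refine and_congr_right fun _ => ?_
  rw [← neg_neg (ctx.height v l α), ← map_neg, height_apply, hn]
  push_cast
  constructor <;> intro <;> linarith

lemma isRootletPair_iff {w : (V × ℚ × ℚ) ≃ₗ[ℚ] (V × ℚ × ℚ)} (hw : ctx.ActsAs w v l)
    (hwW : w ∈ ctx.What) (hv : v ∈ ctx.weyl) (hl : l ∈ ctx.corootLattice)
    (hμ : μ ∈ ctx.PosLong) :
    ctx.IsRootletPair μ v l ↔
      ctx.IsMinuscule w ∧ w ctx.alpha0 + ctx.δhat = ctx.emb μ := by
  have hroot : w ctx.alpha0 + ctx.δhat = ctx.emb μ ↔ v ctx.θ = -μ ∧ ctx.B l μ = -2 := by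
    rw [alpha0, hw, emb, δhat]
    simp only [Prod.mk_add_mk, Prod.mk.injEq, map_neg, add_zero, and_true]
    rw [neg_eq_iff_eq_neg]
    refine and_congr_right fun h => ?_
    rw [h, map_neg]
    constructor <;> intro <;> linarith
  rw [hroot]
  constructor
  · intro hP
    refine ⟨⟨hwW, fun β hβ => ?_⟩, hP.map_θ, hP.pairing⟩
    obtain ⟨α, hα, k, hk, rfl⟩ : ∃ α ∈ ctx.Δ, ∃ k : ℤ, 0 ≤ k ∧ β = (α, (k : ℚ), 0) := by
      rcases hβ.1 with ⟨α, hα, rfl⟩ | ⟨α, hα, k, hk, rfl⟩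
      · exact ⟨α, ctx.pos_subset hα, 0, le_rfl, by simp⟩
      · exact ⟨α, hα, k, by omega, rfl⟩
    rw [mem_Nhat_iff hw hv hl hα] at hβ
    obtain ⟨h1, h2⟩ := hβ
    have hk' : (0 : ℚ) ≤ k := by exact_mod_cast hk
    have hneg : α ∉ ctx.Pos := fun h => by linarith [hP.pos α h]
    have hlt := hP.height_lt_two hμ (ctx.neg_mem_Δ α hα)
    rw [map_neg] at hlt
    rw [ctx.pos_iff hα, not_lt] at hneg
    have k0 : 0 < k := by exact_mod_cast (by linarith : (0 : ℚ) < k)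
    have k2 : k < 2 := by exact_mod_cast (by linarith : (k : ℚ) < 2)
    obtain rfl : k = 1 := by omega
    refine ⟨-α, ctx.neg_pos_of_not_pos hα ?_, by simp [δhat, emb]⟩
    rwa [ctx.pos_iff hα, not_lt]
  · rintro ⟨hmin, hθ, hl2⟩
    refine ⟨hv, hl, fun γ hγ => ?_, hθ, hl2⟩
    by_contra hc
    have hγΔ := ctx.pos_subset hγ
    have hne := height_add_int_ne_zero hv hl hγΔ 0
    rw [Int.cast_zero, add_zero] at hne
    have hlt := lt_of_le_of_ne (not_lt.mp hc) hne
    obtain ⟨γ', _, h⟩ := hmin.2 (γ, ((0 : ℤ) : ℚ), 0) ((mem_Nhat_iff hw hv hl hγΔ 0).mpr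
      ⟨by simpa using ctx.apt_pos hγ, by simpa using hlt⟩)
    simp [δhat, emb] at h

lemma idealOf_eq {w : (V × ℚ × ℚ) ≃ₗ[ℚ] (V × ℚ × ℚ)} (hw : ctx.ActsAs w v l)
    (hv : v ∈ ctx.weyl) (hl : l ∈ ctx.corootLattice) : ctx.idealOf w = ctx.pairIdeal v l := by
  ext γ
  refine and_congr_right fun hγ => ?_
  have h : ctx.δhat - ctx.emb γ = (-γ, ((1 : ℤ) : ℚ), 0) := by simp [δhat, emb]
  have hΔ := ctx.neg_mem_Δ γ (ctx.pos_subset hγ)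
  have := ctx.neg_one_lt_apt hΔ
  rw [h, mem_Nhat_iff hw hv hl hΔ, map_neg (ctx.height v l), Int.cast_one]
  constructor
  · intro h; linarith [h.2]
  · intro h; constructor <;> linarith

lemma mem_abFiber_iff (hμ : μ ∈ ctx.PosLong) {I : Set V} :
    I ∈ ctx.AbFiber μ ↔ ∃ v l, ctx.IsRootletPair μ v l ∧ I = ctx.pairIdeal v l := by
  constructor
  · rintro ⟨_, w, hmin, rfl, hroot⟩
    obtain ⟨v, hv, l, hl, hw⟩ := ctx.exists_actsAs hmin.1
    exact ⟨v, l, (isRootletPair_iff hw hmin.1 hv hl hμ).mpr ⟨hmin, hroot⟩,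
      idealOf_eq hw hv hl⟩
  · rintro ⟨v, l, hP, rfl⟩
    obtain ⟨w, hwW, hw⟩ := ctx.exists_mem_What_actsAs hP.mem_weyl hP.mem_lattice
    obtain ⟨hmin, hroot⟩ := (isRootletPair_iff hw hwW hP.mem_weyl hP.mem_lattice hμ).mp hP
    refine ⟨⟨ctx.θ, ctx.θ_pos, ?_⟩, w, hmin, idealOf_eq hw hP.mem_weyl hP.mem_lattice, hroot⟩
    rw [hP.height_θ]
    linarith [ctx.apt_lt_one (ctx.pos_subset hμ.1)]

/-! ### Adding or removing a root orthogonal to the highest root -/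

lemma reflected_bounds {f : V →ₗ[ℚ] ℚ} {γ : V} (hγ : γ ∈ ctx.Pos)
    (hpos : ∀ τ ∈ ctx.Pos, 0 < f τ) (hlt : ∀ β ∈ ctx.Δ, f β < 2)
    (habove : ∀ τ ∈ ctx.Pos, γ + τ ∈ ctx.Δ → 1 < f (γ + τ) ∧ f τ < 1)
    (hbelow : ∀ τ ∈ ctx.Pos, ∀ σ ∈ ctx.Pos, τ + σ = γ → f τ < 1)
    {ε : V} (hε : ε ∈ ctx.Pos) (hne : ε ≠ γ) :
    0 < f ε - ctx.B (ctx.coroot γ) ε * (f γ - 1) ∧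
      (1 < f ε - ctx.B (ctx.coroot γ) ε * (f γ - 1) ↔ 1 < f ε) := by
  have hγΔ := ctx.pos_subset hγ
  have hεΔ := ctx.pos_subset hε
  obtain ⟨m, hm, hm1, hm2⟩ := ctx.coroot_int_bounds hγΔ hεΔ hne
    (fun h => ctx.pos_not_neg γ hγ (h ▸ hε))
  have hE := hpos ε hε
  have hG := hpos γ hγ
  have hG2 := hlt γ hγΔ
  have hrefl : ε - (m : ℚ) • γ ∈ ctx.Δ := by
    have := ctx.sref_mem hγΔ hεΔ
    rwa [sref_apply, hm] at this
  have hrefl2 : ∀ c : ℚ, ε + c • γ ∈ ctx.Δ → ε - ((m : ℚ) + c) • γ ∈ ctx.Δ := fun c hc => by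
    have := ctx.sref_mem hγΔ hc
    rw [sref_apply, map_add, map_smul, hm, ctx.coroot_self hγΔ, smul_eq_mul] at this
    convert this using 1
    module
  rw [hm]
  rcases lt_trichotomy m 0 with h0 | rfl | h0
  · have hadd : γ + ε ∈ ctx.Pos := ctx.add_mem_pos hγ hε
      ((ctx.coroot_neg_iff hγΔ ε).mp (by rw [hm]; exact_mod_cast h0))
    obtain ⟨hA, hE1⟩ := habove ε hε (ctx.pos_subset hadd)
    have hr := hlt _ hrefl
    have hr2 := hrefl2 1 (by rw [one_smul, add_comm]; exact ctx.pos_subset hadd)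
    have hcontra : ε + (2 : ℚ) • γ ∉ ctx.Δ := fun h => by
      have h' := (habove _ hadd (by convert h using 1; module)).2
      linarith
    simp only [map_add, map_sub, map_smul, smul_eq_mul] at hr hA
    have h3 : m = -1 ∨ m = -2 ∨ m = -3 := by omega
    rcases h3 with rfl | rfl | rfl
    · push_cast at *
      refine ⟨by linarith, fun h => ?_, fun h => ?_⟩ <;> linarith
    · exact absurd (by convert hrefl using 1; push_cast; module) hcontra
    · exact absurd (by convert hr2 using 1; push_cast; module) hcontra
  · simpa using hE
  · have hsub : γ - ε ∈ ctx.Δ := ctx.sub_mem hγΔ hεΔ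
      ((ctx.coroot_pos_iff hγΔ ε).mp (by rw [hm]; exact_mod_cast h0)) hne
    have hr := hlt _ (ctx.neg_mem_Δ _ hrefl)
    have h3 : m = 1 ∨ m = 2 ∨ m = 3 := by omega
    rcases ctx.mem_pos_or_neg_pos _ hsub with hτ | hσ
    · have hE1 := hbelow ε hε _ hτ (by abel)
      have hτ1 := hbelow _ hτ ε hε (by abel)
      have hτ0 := hpos _ hτ
      simp only [map_sub, map_neg, map_smul, smul_eq_mul] at hr hτ1 hτ0
      rcases h3 with rfl | rfl | rfl
      · push_cast at *
        refine ⟨by nlinarith, fun h => ?_, fun h => ?_⟩ <;> linarith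
      · have h1 := (habove _ hτ (by
          convert ctx.neg_mem_Δ _ hrefl using 1; push_cast; module)).1
        simp only [map_add, map_sub] at h1
        push_cast at *
        refine ⟨by linarith, fun h => ?_, fun h => ?_⟩ <;> linarith
      · exfalso
        have h2 : γ + (γ - ε) ∈ ctx.Δ := by
          have := ctx.neg_mem_Δ _ (hrefl2 (-1) (by
            convert ctx.neg_mem_Δ _ hsub using 1; module))
          convert this using 1; push_cast; module
        have h4 := (habove _ hτ h2).1
        have h5 := (habove _ (ctx.add_pos_mem _ hγ _ hτ h2) (by
          convert ctx.neg_mem_Δ _ hrefl using 1; push_cast; module)).2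
        linarith
    · rw [neg_sub] at hσ
      have h1 := (habove _ hσ (by rwa [add_sub_cancel])).1
      have hσ0 := hpos _ hσ
      rw [add_sub_cancel] at h1
      simp only [map_sub, map_neg, map_smul, smul_eq_mul] at hr hσ0
      suffices h : 1 < f ε - (m : ℚ) * (f γ - 1) from
        ⟨by linarith, fun _ => h1, fun _ => h⟩
      rcases h3 with rfl | rfl | rfl
      · push_cast at *; linarith
      · have h2 : f ((2 : ℚ) • γ - ε) < 1 := by
          have hζ : (2 : ℚ) • γ - ε ∈ ctx.Δ := by
            convert ctx.neg_mem_Δ _ hrefl using 1; push_cast; module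
          rcases ctx.mem_pos_or_neg_pos _ hζ with h | h
          · exact hbelow _ h _ hσ (by module)
          · have := hpos _ h
            rw [map_neg] at this
            linarith
        simp only [map_sub, map_smul, smul_eq_mul] at h2
        push_cast at *; linarith
      · push_cast at *; linarith

lemma height_reflected (hv : v ∈ ctx.weyl) (l : V) {γ : V} (hγ : γ ∈ ctx.Δ) (y : V) :
    ctx.height (v * ctx.sref γ) (l - ctx.coroot (v γ)) y =
      ctx.height v l y - ctx.B (ctx.coroot γ) y * (ctx.height v l γ - 1) := by
  have hiso := ctx.weyl_isometry hv
  have h : ctx.B (ctx.coroot (v γ)) (v (ctx.sref γ y)) = -ctx.B (ctx.coroot γ) y := by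
    rw [ctx.coroot_map hiso, hiso, ctx.coroot_sref hγ]
  rw [height_apply, LinearEquiv.mul_apply, map_sub ctx.B, LinearMap.sub_apply, h]
  simp only [height_apply, sref_apply, map_sub, map_smul, smul_eq_mul]
  ring

/-- Two abelian ideals differing in a single root orthogonal to `θ` can be exchanged. -/
lemma exists_abFiber_toggle (hμ : μ ∈ ctx.PosLong) {I J : Set V} {γ : V}
    (hI : I ∈ ctx.AbFiber μ) (hJ : ctx.IsAbelianIdeal J) (hγ : γ ∈ J)
    (hK : ctx.IsAbelianIdeal (J \ {γ})) (hθ : ctx.B ctx.θ γ = 0)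
    (hIJ : ∀ ε, ε ≠ γ → (ε ∈ I ↔ ε ∈ J)) :
    ∃ I' ∈ ctx.AbFiber μ, (∀ ε, ε ≠ γ → (ε ∈ I' ↔ ε ∈ I)) ∧ (γ ∈ I' ↔ γ ∉ I) := by
  obtain ⟨v, l, hP, rfl⟩ := (mem_abFiber_iff hμ).mp hI
  have hγP := hJ.1 hγ
  have hγΔ := ctx.pos_subset hγP
  have hmem : ∀ {ε}, ε ∈ ctx.Pos → ε ≠ γ → (ε ∈ J ↔ 1 < ctx.height v l ε) :=
    fun h hne => (hIJ _ hne).symm.trans (and_iff_right h)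
  have hne1 : ∀ {β}, β ∈ ctx.Δ → ctx.height v l β ≠ 1 := fun hβ h =>
    height_add_int_ne_zero hP.mem_weyl hP.mem_lattice hβ (-1) (by rw [h]; norm_num)
  have hnot : ∀ {ε}, ε ∈ ctx.Pos → ε ≠ γ → ε ∉ J → ctx.height v l ε < 1 := fun h hne hn =>
    lt_of_le_of_ne (not_lt.mp (mt (hmem h hne).mpr hn)) (hne1 (ctx.pos_subset h))
  have hbounds := fun ε => reflected_bounds (f := ctx.height v l) (ε := ε) hγP hP.pos
    (fun β hβ => hP.height_lt_two hμ hβ)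
    (fun τ hτ h => by
      have h0 := ctx.ne_zero_of_mem (ctx.pos_subset hτ)
      refine ⟨(hmem (ctx.add_pos_mem _ hγP _ hτ h) (by simpa using h0)).mp
        (hJ.2.2 γ hγ τ hτ h), ?_⟩
      have hτJ : τ ∉ J := fun h' => hJ.2.1 γ hγ τ h' h
      exact hnot hτ (fun h' => hτJ (h' ▸ hγ)) hτJ)
    (fun τ hτ σ hσ h => by
      have hne : τ ≠ γ := fun h' => ctx.ne_zero_of_mem (ctx.pos_subset hσ)
        (by simpa [h'] using h)
      refine hnot hτ hne fun hτJ => ?_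
      have := hK.2.2 τ ⟨hτJ, hne⟩ σ hσ (h ▸ hγΔ)
      exact this.2 h)
  have hh := height_reflected hP.mem_weyl l hγΔ
  have hhγ := hh γ
  rw [ctx.coroot_self hγΔ] at hhγ
  have hγ2 := hP.height_lt_two hμ hγΔ
  have hvΔ := ctx.weyl_mem hP.mem_weyl hγΔ
  have hP' : ctx.IsRootletPair μ (v * ctx.sref γ) (l - ctx.coroot (v γ)) := by
    refine ⟨mul_mem hP.mem_weyl (ctx.sref_mem_weyl hγΔ),
      AddSubgroup.sub_mem _ hP.mem_lattice (ctx.coroot_mem_lattice hvΔ), fun ε hε => ?_, ?_, ?_⟩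
    · by_cases hε' : ε = γ
      · subst hε'; linarith
      · rw [hh]; exact (hbounds ε hε hε').1
    · have : ctx.B (ctx.coroot γ) ctx.θ = 0 := by
        rw [ctx.coroot_eq_zero_iff hγΔ, ctx.B_symm, hθ]
      rw [LinearEquiv.mul_apply, sref_apply, this, zero_smul, sub_zero, hP.map_θ]
    · have : ctx.B (ctx.coroot (v γ)) μ = 0 := by
        rw [ctx.coroot_eq_zero_iff hvΔ, ← neg_neg μ, ← hP.map_θ, map_neg,
          ctx.weyl_isometry hP.mem_weyl, ctx.B_symm, hθ, neg_zero]
      rw [map_sub, LinearMap.sub_apply, this, sub_zero, hP.pairing]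
  refine ⟨_, (mem_abFiber_iff hμ).mpr ⟨_, _, hP', rfl⟩, fun ε hε' => ?_, ?_⟩
  · refine and_congr_right fun hε => ?_
    rw [hh]
    exact (hbounds ε hε hε').2
  · simp only [pairIdeal, Set.mem_sep_iff, hγP, true_and, hhγ, not_lt]
    refine ⟨fun h => by linarith, fun h => ?_⟩
    linarith [lt_of_le_of_ne h (hne1 hγΔ)]

/-- Removing a root orthogonal to `θ` does not change the rootlet. -/
lemma mem_abFiber_diff_singleton_iff (hμ : μ ∈ ctx.PosLong) {J : Set V} {γ : V}
    (hJ : ctx.IsAbelianIdeal J) (hγ : γ ∈ J) (hK : ctx.IsAbelianIdeal (J \ {γ}))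
    (hθ : ctx.B ctx.θ γ = 0) : J \ {γ} ∈ ctx.AbFiber μ ↔ J ∈ ctx.AbFiber μ := by
  constructor <;> intro hI
  · obtain ⟨I', hI', h1, h2⟩ := exists_abFiber_toggle hμ hI hJ hγ hK hθ
      (fun ε hε => by simp [hε])
    convert hI'
    ext ε
    by_cases hε : ε = γ
    · subst hε; simp [hγ, h2]
    · simp [h1 ε hε, hε]
  · obtain ⟨I', hI', h1, h2⟩ := exists_abFiber_toggle hμ hI hJ hγ hK hθ
      (fun ε _ => Iff.rfl)
    convert hI'
    ext ε
    by_cases hε : ε = γ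
    · subst hε; simp [hγ, h2]
    · simp [h1 ε hε, hε]

lemma abFiber_iff_of_subset (hμ : μ ∈ ctx.PosLong) {J : Set V} (hJ : ctx.IsAbelianIdeal J) :
    ∀ n : ℕ, ∀ I : Set V, (I \ J).ncard = n → ctx.IsAbelianIdeal I → J ⊆ I →
      (∀ γ ∈ I, γ ∉ J → ctx.B ctx.θ γ = 0) → (J ∈ ctx.AbFiber μ ↔ I ∈ ctx.AbFiber μ) := by
  intro n
  induction n with
  | zero =>
    intro I hn hI hJI _
    have hfin : (I \ J).Finite := ctx.pos_finite.subset (Set.sdiff_subset.trans hI.1)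
    rw [Set.ncard_eq_zero hfin, Set.sdiff_eq_empty] at hn
    rw [hn.antisymm hJI]
  | succ n ih =>
    intro I hn hI hJI hθ
    have hfin : (I \ J).Finite := ctx.pos_finite.subset (Set.sdiff_subset.trans hI.1)
    obtain ⟨γ, ⟨hγI, hγJ⟩, hmin⟩ := Set.exists_min_image (I \ J) (ctx.B ctx.apt) hfin
      (Set.nonempty_of_ncard_ne_zero (by omega))
    have hK : ctx.IsAbelianIdeal (I \ {γ}) := by
      refine ⟨Set.sdiff_subset.trans hI.1, fun a ha b hb => hI.2.1 a ha.1 b hb.1,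
        fun a ha b hb hab => ⟨hI.2.2 a ha.1 b hb hab, fun h => ?_⟩⟩
      have h : a + b = γ := h
      by_cases haJ : a ∈ J
      · exact hγJ (h ▸ hJ.2.2 a haJ b hb hab)
      · have h1 := hmin a ⟨ha.1, haJ⟩
        have h2 := ctx.apt_pos hb
        rw [← h, map_add] at h1
        linarith
    rw [← mem_abFiber_diff_singleton_iff hμ hI hγI hK (hθ γ hγI hγJ)]
    refine ih _ ?_ hK (fun a ha => ⟨hJI ha, fun h => hγJ (h ▸ ha)⟩)
      (fun a ha => hθ a ha.1)
    have hγ : γ ∈ I \ J := ⟨hγI, hγJ⟩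
    rw [Set.sdiff_sdiff_comm, Set.ncard_sdiff_singleton_of_mem hγ, hn]
    rfl

/-! ### The least and the greatest ideal with a given rootlet -/

/-- There is an ideal with rootlet `μ` none of whose elements is orthogonal to `θ`. -/
lemma exists_mem_abFiber_not_orthogonal (hμ : μ ∈ ctx.PosLong) :
    ∃ I ∈ ctx.AbFiber μ, ∀ γ ∈ I, ctx.B ctx.θ γ ≠ 0 := by
  have hμΔ := ctx.pos_subset hμ.1
  obtain ⟨v, hv, hnonneg⟩ := ctx.exists_weyl_pos (ctx.B (ctx.apt + -ctx.coroot μ))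
  have hiso := ctx.weyl_isometry hv
  have hl : -ctx.coroot μ ∈ ctx.corootLattice := neg_mem (ctx.coroot_mem_lattice hμΔ)
  have hpos : ∀ γ ∈ ctx.Pos, 0 < ctx.height v (-ctx.coroot μ) γ := fun γ hγ => by
    have hne := height_add_int_ne_zero hv hl (ctx.pos_subset hγ) 0
    rw [Int.cast_zero, add_zero] at hne
    exact lt_of_le_of_ne (hnonneg γ hγ) hne.symm
  have hdom : ∀ γ ∈ ctx.Pos, ctx.B μ (v γ) ≤ 0 := fun γ hγ => by
    have hvΔ := ctx.weyl_mem hv (ctx.pos_subset hγ)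
    obtain ⟨n, hn⟩ := ctx.exists_int hμΔ hvΔ
    have h1 := hpos γ hγ
    have h2 := ctx.apt_lt_one hvΔ
    rw [height_apply, map_neg, LinearMap.neg_apply, hn] at h1
    have h3 : n < 1 := by exact_mod_cast (by linarith : (n : ℚ) < 1)
    by_contra! h4
    have h5 := (ctx.coroot_pos_iff hμΔ _).mpr h4
    rw [hn] at h5
    have h6 : 0 < n := by exact_mod_cast h5
    omega
  have hvθ : v ctx.θ = -μ := by
    have hvv : v (v⁻¹ (-μ)) = -μ := v.apply_symm_apply _
    have h := ctx.eq_θ_of_dominant (α := v⁻¹ (-μ))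
      ((ctx.weyl_mem_iff hv _).mp (by rw [hvv]; exact ctx.neg_mem_Δ _ hμΔ))
      (by rw [← hiso, hvv, map_neg, map_neg, LinearMap.neg_apply, neg_neg, hμ.2])
      (fun β hβ => by
        rw [← hiso, hvv, map_neg, LinearMap.neg_apply]
        linarith [hdom β hβ])
    rw [← h, hvv]
  refine ⟨_, (mem_abFiber_iff hμ).mpr ⟨v, -ctx.coroot μ, ⟨hv, hl, hpos, hvθ, ?_⟩, rfl⟩, ?_⟩
  · rw [map_neg, LinearMap.neg_apply, ctx.coroot_self hμΔ]
  · rintro γ ⟨hγ, hh⟩ hθ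
    have h1 : ctx.B (ctx.coroot μ) (v γ) = 0 := by
      rw [ctx.coroot_eq_zero_iff hμΔ, ← neg_neg μ, ← hvθ, map_neg, LinearMap.neg_apply, hiso,
        hθ, neg_zero]
    have h2 := ctx.apt_lt_one (ctx.weyl_mem hv (ctx.pos_subset hγ))
    rw [height_apply, map_neg, LinearMap.neg_apply, h1] at hh
    linarith

lemma IsRootletPair.translation_eq (hP : ctx.IsRootletPair μ v l) (hμ : μ ∈ ctx.PosLong)
    (hI : ∀ γ ∈ ctx.pairIdeal v l, ctx.B ctx.θ γ ≠ 0) : l = -ctx.coroot μ := by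
  have hiso := ctx.weyl_isometry hP.mem_weyl
  have hμΔ := ctx.pos_subset hμ.1
  have hcor : ∀ y, ctx.B (ctx.coroot μ) (v y) = -ctx.B (ctx.coroot ctx.θ) y := fun y => by
    rw [← neg_neg μ, ← hP.map_θ, coroot_neg, ctx.coroot_map hiso, map_neg, LinearMap.neg_apply,
      hiso]
  have hbound : ∀ γ ∈ ctx.Pos, -1 ≤ ctx.B (l + ctx.coroot μ) (v γ) ∧
      ctx.B (l + ctx.coroot μ) (v γ) ≤ 1 := fun γ hγ => by
    have hγΔ := ctx.pos_subset hγ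
    have hvΔ := ctx.weyl_mem hP.mem_weyl hγΔ
    obtain ⟨n, hn⟩ := ctx.lattice_int hP.mem_lattice hvΔ
    have h1 := hP.pos γ hγ
    have h2 := hP.height_lt_two hμ hγΔ
    have h3 := ctx.apt_lt_one hvΔ
    have h4 := ctx.neg_one_lt_apt hvΔ
    have h5 : ctx.height v l γ = ctx.B ctx.apt (v γ) + n := by rw [height_apply, hn]
    have n0 : -1 < n := by exact_mod_cast (by linarith : (-1 : ℚ) < n)
    have n3 : n < 3 := by exact_mod_cast (by linarith : (n : ℚ) < 3)
    rw [map_add, LinearMap.add_apply, hcor, hn]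
    by_cases hθ : ctx.B ctx.θ γ = 0
    · rw [(ctx.coroot_eq_zero_iff ctx.θ_mem γ).mpr hθ]
      have h6 : ¬ 1 < ctx.height v l γ := fun h => hI γ ⟨hγ, h⟩ hθ
      have n2 : n < 2 := by exact_mod_cast (by linarith : (n : ℚ) < 2)
      have n0' : (0 : ℚ) ≤ n := by exact_mod_cast (by omega : 0 ≤ n)
      have n1' : (n : ℚ) ≤ 1 := by exact_mod_cast (by omega : n ≤ 1)
      constructor <;> linarith
    · by_cases hγθ : γ = ctx.θ
      · subst hγθ
        rw [ctx.coroot_self ctx.θ_mem, ← hn, hP.map_θ, map_neg, hP.pairing]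
        norm_num
      · rw [ctx.coroot_θ_eq_one hγ (lt_of_le_of_ne (ctx.θ_dominant hγ) (Ne.symm hθ)) hγθ]
        have n0' : (0 : ℚ) ≤ n := by exact_mod_cast (by omega : 0 ≤ n)
        have n2' : (n : ℚ) ≤ 2 := by exact_mod_cast (by omega : n ≤ 2)
        constructor <;> linarith
  refine eq_neg_of_add_eq_zero_left (ctx.eq_zero_of_mem_lattice
    (AddSubgroup.add_mem _ hP.mem_lattice (ctx.coroot_mem_lattice hμΔ)) fun β hβ => ?_)
  obtain ⟨γ, rfl⟩ := v.surjective β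
  rcases ctx.mem_pos_or_neg_pos γ ((ctx.weyl_mem_iff hP.mem_weyl γ).mp hβ) with h | h
  · exact (hbound γ h).2
  · have := (hbound _ h).1
    rw [map_neg v, map_neg] at this
    linarith

lemma IsRootletPair.weyl_unique {v' : V ≃ₗ[ℚ] V} (hP : ctx.IsRootletPair μ v l)
    (hP' : ctx.IsRootletPair μ v' l) : v = v' := by
  have hu := mul_mem (inv_mem hP.mem_weyl) hP'.mem_weyl
  refine inv_mul_eq_one.mp (ctx.weyl_eq_one hu fun α hα => ?_)
  have hΔ := ctx.weyl_mem hu (ctx.pos_subset hα)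
  have heq : ctx.height v l ((v⁻¹ * v') α) = ctx.height v' l α := by
    have : v (v⁻¹ (v' α)) = v' α := v.apply_symm_apply _
    rw [height_apply, height_apply, LinearEquiv.mul_apply, this]
  rcases ctx.mem_pos_or_neg_pos _ hΔ with h | h
  · exact h
  · have h1 := hP.pos _ h
    have h2 := hP'.pos α hα
    rw [map_neg, heq] at h1
    linarith

lemma eq_of_not_orthogonal (hμ : μ ∈ ctx.PosLong) {I J : Set V} (hI : I ∈ ctx.AbFiber μ)
    (hJ : J ∈ ctx.AbFiber μ) (hIθ : ∀ γ ∈ I, ctx.B ctx.θ γ ≠ 0)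
    (hJθ : ∀ γ ∈ J, ctx.B ctx.θ γ ≠ 0) : I = J := by
  obtain ⟨v, l, hP, rfl⟩ := (mem_abFiber_iff hμ).mp hI
  obtain ⟨v', l', hP', rfl⟩ := (mem_abFiber_iff hμ).mp hJ
  obtain rfl := hP.translation_eq hμ hIθ
  obtain rfl := hP'.translation_eq hμ hJθ
  rw [hP.weyl_unique hP']

lemma isAbelianIdeal_of_mem_abFiber (hμ : μ ∈ ctx.PosLong) {I : Set V}
    (hI : I ∈ ctx.AbFiber μ) : ctx.IsAbelianIdeal I := by
  obtain ⟨v, l, hP, rfl⟩ := (mem_abFiber_iff hμ).mp hI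
  exact hP.isAbelianIdeal hμ

lemma mem_abFiber_not_orthogonal_iff (hμ : μ ∈ ctx.PosLong) {I : Set V}
    (hI : ctx.IsAbelianIdeal I) :
    {γ ∈ I | ctx.B ctx.θ γ ≠ 0} ∈ ctx.AbFiber μ ↔ I ∈ ctx.AbFiber μ := by
  have hsub : {γ ∈ I | ctx.B ctx.θ γ ≠ 0} ⊆ I := Set.sep_subset _ _
  refine abFiber_iff_of_subset hμ ⟨hsub.trans hI.1, fun a ha b hb => hI.2.1 a ha.1 b hb.1,
    fun a ha b hb hab => ⟨hI.2.2 a ha.1 b hb hab, ?_⟩⟩ _ I rfl hI hsub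
    (fun γ hγ h => by_contra fun h' => h ⟨hγ, h'⟩)
  have h1 := lt_of_le_of_ne (ctx.θ_dominant (hI.1 ha.1)) (Ne.symm ha.2)
  have h2 := ctx.θ_dominant hb
  rw [map_add]
  linarith

/-- A positive root orthogonal to `θ` pairs negatively with some positive root. -/
lemma exists_pos_neg_pairing {σ : V} (hσ : σ ∈ ctx.Pos) (hθ : ctx.B ctx.θ σ = 0) :
    ∃ ν ∈ ctx.Pos, ctx.B σ ν < 0 := by
  by_contra! hc
  have h1 := ctx.map_nonneg_of_mem_cone hc (ctx.θ_highest σ (ctx.pos_subset hσ))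
  have h2 := ctx.self_pos (ctx.pos_subset hσ)
  rw [map_sub, ctx.B_symm, hθ] at h1
  linarith

lemma isAbelianIdeal_sUnion {F : Set (Set V)} {I₀ : Set V}
    (hF : ∀ I ∈ F, ctx.IsAbelianIdeal I) (hI₀ : ∀ I ∈ F, {γ ∈ I | ctx.B ctx.θ γ ≠ 0} = I₀) :
    ctx.IsAbelianIdeal (⋃₀ F) := by
  refine ⟨Set.sUnion_subset fun I hI => (hF I hI).1, ?_, ?_⟩
  · suffices h : ∀ n : ℕ, ∀ a ∈ ⋃₀ F, ∀ b ∈ ⋃₀ F, a + b ∈ ctx.Δ →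
        {τ ∈ ctx.Pos | ctx.B ctx.apt (a + b) < ctx.B ctx.apt τ}.ncard = n → False from
      fun a ha b hb hab => h _ a ha b hb hab rfl
    intro n
    induction n using Nat.strong_induction_on with
    | _ n ih =>
      rintro a ⟨I, hI, haI⟩ b ⟨J, hJ, hbJ⟩ hab hn
      have ha := (hF I hI).1 haI
      have hb := (hF J hJ).1 hbJ
      have hθa : ctx.B ctx.θ a = 0 := by
        by_contra h
        have haI₀ : a ∈ I₀ := hI₀ I hI ▸ ⟨haI, h⟩
        rw [← hI₀ J hJ] at haI₀
        exact (hF J hJ).2.1 a haI₀.1 b hbJ hab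
      have hθb : ctx.B ctx.θ b = 0 := by
        by_contra h
        have hbI₀ : b ∈ I₀ := hI₀ J hJ ▸ ⟨hbJ, h⟩
        rw [← hI₀ I hI] at hbI₀
        exact (hF I hI).2.1 a haI b hbI₀.1 hab
      have hσ := ctx.add_pos_mem a ha b hb hab
      obtain ⟨ν, hν, hneg⟩ := exists_pos_neg_pairing hσ (by rw [map_add, hθa, hθb, add_zero])
      have hσν := ctx.add_mem_pos hσ hν hneg
      have hlt : {τ ∈ ctx.Pos | ctx.B ctx.apt (a + b + ν) < ctx.B ctx.apt τ}.ncard < n := by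
        have hνpos := ctx.apt_pos hν
        rw [← hn]
        refine Set.ncard_lt_ncard ⟨fun τ hτ => ⟨hτ.1, ?_⟩, fun h => ?_⟩
          (ctx.pos_finite.subset (Set.sep_subset _ _))
        · have := hτ.2
          rw [map_add] at this
          linarith
        · have := h (⟨hσν, by rw [map_add _ (a + b)]; linarith⟩ :
            a + b + ν ∈ {τ ∈ ctx.Pos | ctx.B ctx.apt (a + b) < ctx.B ctx.apt τ})
          exact lt_irrefl _ this.2
      rw [map_add, LinearMap.add_apply] at hneg
      rcases lt_or_ge (ctx.B a ν) 0 with h | h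
      · have haν := ctx.pos_subset (ctx.add_mem_pos ha hν h)
        have heq : a + ν + b = a + b + ν := by abel
        exact ih _ hlt (a + ν) ⟨I, hI, (hF I hI).2.2 a haI ν hν haν⟩ b ⟨J, hJ, hbJ⟩
          (heq ▸ ctx.pos_subset hσν) (by rw [heq])
      · have hbν := ctx.pos_subset (ctx.add_mem_pos hb hν (by linarith))
        have heq : a + (b + ν) = a + b + ν := by abel
        exact ih _ hlt a ⟨I, hI, haI⟩ (b + ν) ⟨J, hJ, (hF J hJ).2.2 b hbJ ν hν hbν⟩
          (heq ▸ ctx.pos_subset hσν) (by rw [heq])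
  · rintro a ⟨I, hI, ha⟩ b hb hab
    exact ⟨I, hI, (hF I hI).2.2 a ha b hb hab⟩

lemma exists_least_greatest_abFiber (hμ : μ ∈ ctx.PosLong) :
    ∃ Imin Imax : Set V, Imin ∈ ctx.AbFiber μ ∧ Imax ∈ ctx.AbFiber μ ∧
      ∀ I ∈ ctx.AbFiber μ, Imin ⊆ I ∧ I ⊆ Imax := by
  obtain ⟨I₀, hI₀, hI₀θ⟩ := exists_mem_abFiber_not_orthogonal hμ
  have hab : ∀ I ∈ ctx.AbFiber μ, ctx.IsAbelianIdeal I :=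
    fun I hI => isAbelianIdeal_of_mem_abFiber hμ hI
  have heq : ∀ I ∈ ctx.AbFiber μ, {γ ∈ I | ctx.B ctx.θ γ ≠ 0} = I₀ := fun I hI =>
    eq_of_not_orthogonal hμ ((mem_abFiber_not_orthogonal_iff hμ (hab I hI)).mpr hI) hI₀
      (fun γ hγ => hγ.2) hI₀θ
  have hmin : ∀ I ∈ ctx.AbFiber μ, I₀ ⊆ I := fun I hI => heq I hI ▸ Set.sep_subset _ _
  refine ⟨I₀, ⋃₀ ctx.AbFiber μ, hI₀, ?_,
    fun I hI => ⟨hmin I hI, Set.subset_sUnion_of_mem hI⟩⟩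
  rw [← mem_abFiber_not_orthogonal_iff hμ (isAbelianIdeal_sUnion hab heq)]
  convert hI₀
  ext γ
  constructor
  · rintro ⟨⟨I, hI, hγ⟩, hθ⟩
    exact heq I hI ▸ ⟨hγ, hθ⟩
  · exact fun hγ => ⟨⟨I₀, hI₀, hγ⟩, hI₀θ γ hγ⟩

end RootSystemCtx

/-- from Theorem `main`: for every long positive root `μ`, the
poset `Ab_μ` is nonempty and has a least and a greatest element. -/
theorem statement_11 {V : Type*} [AddCommGroup V] [Module ℚ V] (ctx : RootSystemCtx V)
    (μ : V) (hμ : μ ∈ ctx.PosLong) :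
    ∃ Imin Imax : Set V, Imin ∈ ctx.AbFiber μ ∧ Imax ∈ ctx.AbFiber μ ∧
      ∀ I ∈ ctx.AbFiber μ, Imin ⊆ I ∧ I ⊆ Imax := by
  exact RootSystemCtx.exists_least_greatest_abFiber hμ
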